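/- A formula of MMSO (monadic second-order logic for monotone neighborhood models) is invariant for global neighborhood bisimulations if and only if it is equivalent, over all pointed monotone neighborhood models, to a formula of μMML_g, the monotone modal μ-calculus extended with the global modalities. -/

import Mathlib

open scoped Classical

/-- The monotone neighborhood functor on objects: upward-closed collections of subsets. -/
def MObj (X : Type) : Type :=
  {N : Set (Set X) // ∀ Z Z' : Set X, Z ∈ N → Z ⊆ Z' → Z' ∈ N}

/-- Updating a valuation at one proposition letter. -/
noncomputable def updV {X : Type} (V : ℕ → Set X) (p : ℕ) (Z : Set X) : ℕ → Set X :=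
  fun q => if q = p then Z else V q

/-- The second-order language `MMSO` for monotone neighborhood models. -/
inductive MMSOForm : Type
  | sr (p : ℕ)
  | subset (p q : ℕ)
  | box (p q : ℕ)
  | ex (p : ℕ) (φ : MMSOForm)
  | neg (φ : MMSOForm)
  | or (φ ψ : MMSOForm)

/-- Satisfaction of `MMSO`-formulas at a pointed monotone neighborhood model:
`□(p,q)` holds iff every `v ∈ V(p)` has a neighborhood `Z ∈ σ(v)` with `Z ⊆ V(q)`. -/
def MMSOForm.sat {S : Type} (σ : S → MObj S) : MMSOForm → (ℕ → Set S) → S → Prop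
  | .sr p, V, u => V p = {u}
  | .subset p q, V, _ => V p ⊆ V q
  | .box p q, V, _ => ∀ v ∈ V p, ∃ Z ∈ (σ v).1, Z ⊆ V q
  | .ex p φ, V, u => ∃ Z : Set S, φ.sat σ (updV V p Z) u
  | .neg φ, V, u => ¬ φ.sat σ V u
  | .or φ ψ, V, u => φ.sat σ V u ∨ ψ.sat σ V u

/-- Neighborhood bisimulations between monotone neighborhood models. -/
def NBisim {S₁ S₂ : Type} (σ₁ : S₁ → MObj S₁) (V₁ : ℕ → Set S₁)
    (σ₂ : S₂ → MObj S₂) (V₂ : ℕ → Set S₂) (R : S₁ → S₂ → Prop) : Prop :=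
  ∀ s₁ s₂, R s₁ s₂ →
    (∀ p : ℕ, s₁ ∈ V₁ p ↔ s₂ ∈ V₂ p) ∧
    (∀ Z₁ ∈ (σ₁ s₁).1, ∃ Z₂ ∈ (σ₂ s₂).1, ∀ t₂ ∈ Z₂, ∃ t₁ ∈ Z₁, R t₁ t₂) ∧
    (∀ Z₂ ∈ (σ₂ s₂).1, ∃ Z₁ ∈ (σ₁ s₁).1, ∀ t₁ ∈ Z₁, ∃ t₂ ∈ Z₂, R t₁ t₂)

/-- Global neighborhood bisimulations: neighborhood bisimulations that are full on
both domain and codomain. -/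
def GlobalNBisim {S₁ S₂ : Type} (σ₁ : S₁ → MObj S₁) (V₁ : ℕ → Set S₁)
    (σ₂ : S₂ → MObj S₂) (V₂ : ℕ → Set S₂) (R : S₁ → S₂ → Prop) : Prop :=
  NBisim σ₁ V₁ σ₂ V₂ R ∧ (∀ u : S₁, ∃ v : S₂, R u v) ∧ (∀ v : S₂, ∃ u : S₁, R u v)

/-- An `MMSO`-formula is invariant for global neighborhood bisimulations. -/
def GlobalBisimInv (φ : MMSOForm) : Prop :=
  ∀ (S₁ : Type) (σ₁ : S₁ → MObj S₁) (V₁ : ℕ → Set S₁) (s₁ : S₁)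
    (S₂ : Type) (σ₂ : S₂ → MObj S₂) (V₂ : ℕ → Set S₂) (s₂ : S₂)
    (R : S₁ → S₂ → Prop),
    GlobalNBisim σ₁ V₁ σ₂ V₂ R → R s₁ s₂ → (φ.sat σ₁ V₁ s₁ ↔ φ.sat σ₂ V₂ s₂)

/-- The monotone modal μ-calculus with the global modalities, `μMML_g`
(in negation normal form). -/
inductive MuG : Type
  | var (p : ℕ)
  | nvar (p : ℕ)
  | bot
  | top
  | box (φ : MuG)
  | dia (φ : MuG)
  | all (φ : MuG)
  | exm (φ : MuG)
  | or (φ ψ : MuG)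
  | and (φ ψ : MuG)
  | mu (p : ℕ) (φ : MuG)
  | nu (p : ℕ) (φ : MuG)

/-- `φ.PosIn p`: no free occurrence of `p` is negated in `φ`. -/
def MuG.PosIn (p : ℕ) : MuG → Prop
  | .var _ => True
  | .nvar q => q ≠ p
  | .bot => True
  | .top => True
  | .box φ => φ.PosIn p
  | .dia φ => φ.PosIn p
  | .all φ => φ.PosIn p
  | .exm φ => φ.PosIn p
  | .or φ ψ => φ.PosIn p ∧ ψ.PosIn p
  | .and φ ψ => φ.PosIn p ∧ ψ.PosIn p
  | .mu q φ => q = p ∨ φ.PosIn p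
  | .nu q φ => q = p ∨ φ.PosIn p

/-- Well-formedness: in every subformula `μp.φ` or `νp.φ`, the formula `φ` is
positive in `p`. -/
def MuG.WF : MuG → Prop
  | .var _ => True
  | .nvar _ => True
  | .bot => True
  | .top => True
  | .box φ => φ.WF
  | .dia φ => φ.WF
  | .all φ => φ.WF
  | .exm φ => φ.WF
  | .or φ ψ => φ.WF ∧ ψ.WF
  | .and φ ψ => φ.WF ∧ ψ.WF
  | .mu p φ => φ.PosIn p ∧ φ.WF
  | .nu p φ => φ.PosIn p ∧ φ.WF

/-- Semantics of `μMML_g`: truth sets in a monotone neighborhood model. `□φ` holds at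
`s` iff `‖φ‖ ∈ σ(s)`; `◇` is its dual; `[∀]`/`[∃]` are the global modalities; `μ`/`ν`
are least/greatest fixpoints. -/
noncomputable def MuG.sem {S : Type} (σ : S → MObj S) : MuG → (ℕ → Set S) → Set S
  | .var p, V => V p
  | .nvar p, V => (V p)ᶜ
  | .bot, _ => ∅
  | .top, _ => Set.univ
  | .box φ, V => {s : S | φ.sem σ V ∈ (σ s).1}
  | .dia φ, V => {s : S | (φ.sem σ V)ᶜ ∉ (σ s).1}
  | .all φ, V => {_s : S | ∀ v : S, v ∈ φ.sem σ V}
  | .exm φ, V => {_s : S | ∃ v : S, v ∈ φ.sem σ V}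
  | .or φ ψ, V => φ.sem σ V ∪ ψ.sem σ V
  | .and φ ψ, V => φ.sem σ V ∩ ψ.sem σ V
  | .mu p φ, V => ⋂₀ {Z : Set S | φ.sem σ (updV V p Z) ⊆ Z}
  | .nu p φ, V => ⋃₀ {Z : Set S | Z ⊆ φ.sem σ (updV V p Z)}

/-! ### Parity condition on sequences of natural numbers -/

/-- The largest number occurring infinitely often is even. -/
def ParityWin (a : ℕ → ℕ) : Prop :=
  ∃ n, Even n ∧ (∃ᶠ i in Filter.atTop, a i = n) ∧ ∀ᶠ i in Filter.atTop, a i ≤ n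

theorem exists_limsup_of_bounded (a : ℕ → ℕ) (b : ℕ) (h : ∀ i, a i ≤ b) :
    ∃ n, (∃ᶠ i in Filter.atTop, a i = n) ∧ ∀ᶠ i in Filter.atTop, a i ≤ n := by
  have hex : ∃ n, ∀ᶠ i in Filter.atTop, a i ≤ n := ⟨b, Filter.Eventually.of_forall h⟩
  refine ⟨Nat.find hex, ?_, Nat.find_spec hex⟩
  intro hne
  have h1 := Nat.find_spec hex
  have h2 : ∀ᶠ i in Filter.atTop, a i < Nat.find hex := by
    filter_upwards [hne, h1] with i hi hi'
    exact lt_of_le_of_ne hi' hi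
  rcases Nat.eq_zero_or_pos (Nat.find hex) with h0 | h0
  · rw [h0] at h2
    obtain ⟨i, hi⟩ := h2.exists
    exact absurd hi (Nat.not_lt_zero _)
  · refine Nat.find_min hex (m := Nat.find hex - 1) (by omega) ?_
    filter_upwards [h2] with i hi
    omega

theorem limsup_unique {a : ℕ → ℕ} {n n' : ℕ}
    (h1 : ∃ᶠ i in Filter.atTop, a i = n) (h2 : ∀ᶠ i in Filter.atTop, a i ≤ n)
    (h1' : ∃ᶠ i in Filter.atTop, a i = n') (h2' : ∀ᶠ i in Filter.atTop, a i ≤ n') : n = n' := by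
  obtain ⟨i, hi, hi'⟩ := (h1.and_eventually h2').exists
  obtain ⟨j, hj, hj'⟩ := (h1'.and_eventually h2).exists
  omega

theorem parityWin_succ_iff {a : ℕ → ℕ} (b : ℕ) (h : ∀ i, a i ≤ b) :
    ParityWin (fun i => a i + 1) ↔ ¬ ParityWin a := by
  obtain ⟨n, h1, h2⟩ := exists_limsup_of_bounded a b h
  constructor
  · rintro ⟨k, hk, hk1, hk2⟩ ⟨l, hl, hl1, hl2⟩
    have e1 : k = l + 1 := by
      refine limsup_unique (a := fun i => a i + 1) hk1 hk2 ?_ ?_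
      · exact hl1.mono fun i hi => by simp [hi]
      · exact hl2.mono fun i hi => by simpa using hi
    subst e1
    exact (Nat.even_add_one.1 hk) hl
  · intro hn
    refine ⟨n + 1, ?_, h1.mono fun i hi => by simp [hi], h2.mono fun i hi => by simpa using hi⟩
    exact Nat.even_add_one.2 fun he => hn ⟨n, he, h1, h2⟩

theorem parityWin_shift {a : ℕ → ℕ} (k : ℕ) (h : ParityWin fun i => a (i + k)) :
    ParityWin a := by
  obtain ⟨n, hn, h1, h2⟩ := h
  refine ⟨n, hn, ?_, ?_⟩
  · rw [Filter.frequently_atTop] at h1 ⊢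
    intro b
    obtain ⟨c, hc, hc'⟩ := h1 b
    exact ⟨c + k, by omega, hc'⟩
  · rw [Filter.eventually_atTop] at h2 ⊢
    obtain ⟨b, hb⟩ := h2
    refine ⟨b + k, fun c hc => ?_⟩
    have := hb (c - k) (by omega)
    simp only at this
    rwa [Nat.sub_add_cancel (by omega)] at this

/-! ### Nested fixpoints of monotone systems -/

section Sol

variable {X : Type}

/-- Iterated solution of the first `n` equations of the system `x q = β q x`, where the
variables with index at least `n` are parameters given by `y`; the `q`-th variable is a greatest
fixpoint if `Ω q` is even and a least fixpoint otherwise. -/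
noncomputable def sol (Ω : ℕ → ℕ) (β : ℕ → (ℕ → Set X) → Set X) :
    ℕ → (ℕ → Set X) → (ℕ → Set X)
  | 0, y => y
  | n + 1, y => sol Ω β n (Function.update y n
      (if Even (Ω n) then ⋃₀ {Z | Z ⊆ β n (sol Ω β n (Function.update y n Z))}
        else ⋂₀ {Z | β n (sol Ω β n (Function.update y n Z)) ⊆ Z}))

variable {Ω : ℕ → ℕ} {β : ℕ → (ℕ → Set X) → Set X}

theorem sol_of_le {n k : ℕ} (h : n ≤ k) (y : ℕ → Set X) : sol Ω β n y k = y k := by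
  induction n generalizing y with
  | zero => rfl
  | succ n ih =>
    rw [sol, ih (by omega), Function.update_of_ne (by omega)]

theorem sol_mono (hβ : ∀ q, Monotone (β q)) (n : ℕ) : Monotone (sol Ω β n) := by
  induction n with
  | zero => exact fun y y' h => h
  | succ n ih =>
    intro y y' h
    have hu : ∀ Z Z' : Set X, Z ⊆ Z' → Function.update y n Z ≤ Function.update y' n Z' :=
      fun Z Z' hZ => update_le_update_iff.2 ⟨hZ, fun j _ => h j⟩
    refine ih (hu _ _ ?_)
    split_ifs
    · exact Set.sUnion_subset_sUnion fun Z hZ => hZ.trans (hβ n (ih (hu Z Z le_rfl)))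
    · exact Set.sInter_subset_sInter fun Z hZ => (hβ n (ih (hu Z Z le_rfl))).trans hZ

theorem sol_compl (n : ℕ) (y : ℕ → Set X) :
    sol (fun q => Ω q + 1) (fun q U => (β q (fun k => (U k)ᶜ))ᶜ) n (fun k => (y k)ᶜ) =
      fun k => (sol Ω β n y k)ᶜ := by
  induction n generalizing y with
  | zero => rfl
  | succ n ih =>
    have hu : ∀ Z : Set X, Function.update (fun k => (y k)ᶜ) n Z =
        fun k => (Function.update y n Zᶜ k)ᶜ := by
      intro Z
      funext k
      by_cases hk : k = n
      · subst hk; simp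
      · simp [hk]
    rw [sol, sol, hu, ih]
    have key : ∀ Z : Set X, sol (fun q => Ω q + 1) (fun q U => (β q (fun k => (U k)ᶜ))ᶜ) n
        (Function.update (fun k => (y k)ᶜ) n Z) =
        fun k => (sol Ω β n (Function.update y n Zᶜ) k)ᶜ := fun Z => by rw [hu, ih]
    simp only [key, compl_compl, Nat.even_add_one]
    by_cases he : Even (Ω n)
    · simp only [he, not_true_eq_false, if_false, if_true]
      have hS : compl '' {Z | (β n fun k => sol Ω β n (Function.update y n Zᶜ) k)ᶜ ⊆ Z} =
          {Z | Z ⊆ β n (sol Ω β n (Function.update y n Z))} := by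
        ext Z
        constructor
        · rintro ⟨Z', h, rfl⟩
          exact Set.compl_subset_comm.1 h
        · intro h
          exact ⟨Zᶜ, by simpa using h, by simp⟩
      rw [Set.compl_sInter, hS]
    · simp only [he, not_false_eq_true, if_false, if_true]
      have hS : compl '' {Z | Z ⊆ (β n fun k => sol Ω β n (Function.update y n Zᶜ) k)ᶜ} =
          {Z | β n (sol Ω β n (Function.update y n Z)) ⊆ Z} := by
        ext Z
        constructor
        · rintro ⟨Z', h, rfl⟩
          exact Set.subset_compl_comm.1 h
        · intro h
          exact ⟨Zᶜ, by simpa using h, by simp⟩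
      rw [Set.compl_sUnion, hS]

/-- Solutions are preserved by taking preimages. -/
theorem sol_preimage {Y : Type} (π : Y → X) {β' : ℕ → (ℕ → Set Y) → Set Y}
    (hβ' : ∀ q, Monotone (β' q))
    (h : ∀ q U, β' q (fun k => π ⁻¹' U k) = π ⁻¹' β q U) (n : ℕ) (y : ℕ → Set X) :
    sol Ω β' n (fun k => π ⁻¹' y k) = fun k => π ⁻¹' sol Ω β n y k := by
  induction n generalizing y with
  | zero => rfl
  | succ n ih =>
    have hu : ∀ Z : Set X, Function.update (fun k => π ⁻¹' y k) n (π ⁻¹' Z) =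
        fun k => π ⁻¹' (Function.update y n Z k) := by
      intro Z
      funext k
      by_cases hk : k = n
      · subst hk; simp
      · simp [hk]
    have hH : ∀ Z : Set X, β' n (sol Ω β' n (Function.update (fun k => π ⁻¹' y k) n (π ⁻¹' Z))) =
        π ⁻¹' β n (sol Ω β n (Function.update y n Z)) := fun Z => by rw [hu, ih, h]
    have hm : ∀ Z Z' : Set Y, Z ⊆ Z' →
        β' n (sol Ω β' n (Function.update (fun k => π ⁻¹' y k) n Z)) ⊆
        β' n (sol Ω β' n (Function.update (fun k => π ⁻¹' y k) n Z')) := fun Z Z' hZ =>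
      hβ' n (sol_mono hβ' n (update_le_update_iff.2 ⟨hZ, fun _ _ => le_rfl⟩))
    rw [sol, sol, ← ih, ← hu]
    congr 2
    split_ifs
    · apply Set.Subset.antisymm
      · refine Set.sUnion_subset fun Z hZ => ?_
        rw [← Set.image_subset_iff]
        refine Set.subset_sUnion_of_mem ?_
        rw [Set.mem_ofPred_eq, Set.image_subset_iff, ← hH]
        exact Set.Subset.trans hZ (hm _ _ (Set.subset_preimage_image π Z))
      · rw [Set.preimage_sUnion]
        refine Set.iUnion₂_subset fun Z hZ => Set.subset_sUnion_of_mem ?_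
        rw [Set.mem_ofPred_eq, hH]
        exact Set.preimage_mono hZ
    · apply Set.Subset.antisymm
      · rw [Set.preimage_sInter]
        refine Set.subset_iInter₂ fun Z hZ => Set.sInter_subset_of_mem ?_
        rw [Set.mem_ofPred_eq, hH]
        exact Set.preimage_mono hZ
      · refine Set.subset_sInter fun Z hZ => ?_
        intro a ha
        have : ⋂₀ {Z | β n (sol Ω β n (Function.update y n Z)) ⊆ Z} ⊆
            {b | π ⁻¹' {b} ⊆ Z} := by
          refine Set.sInter_subset_of_mem ?_
          intro b hb c hc
          have hc' : π c = b := hc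
          subst hc'
          refine hZ (hm (π ⁻¹' {b | π ⁻¹' {b} ⊆ Z}) Z (fun d hd => hd rfl) ?_)
          rw [hH]
          exact hb
        exact this ha rfl

/-- Points of a least fixpoint can be ranked by ordinals. -/
theorem exists_rank_of_lfp {H : Set X → Set X} (hH : Monotone H) :
    ∃ r : X → Ordinal.{0}, ∀ x ∈ ⋂₀ {Z | H Z ⊆ Z},
      x ∈ H {z | z ∈ ⋂₀ {Z | H Z ⊆ Z} ∧ r z < r x} := by
  let A : Ordinal.{0} → Set X := WellFoundedLT.fix fun α A => H {z | ∃ b, ∃ h : b < α, z ∈ A b h}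
  have hA : ∀ α, A α = H {z | ∃ b < α, z ∈ A b} := by
    intro α
    have := WellFoundedLT.fix_eq (fun (α : Ordinal.{0}) (A : (b : Ordinal.{0}) → b < α → Set X) =>
      H {z | ∃ b, ∃ h : b < α, z ∈ A b h}) α
    simpa [A] using this
  let L := ⋂₀ {Z | H Z ⊆ Z}
  let r : X → Ordinal.{0} := fun x => sInf {α | x ∈ A α}
  have hr : ∀ x, (∃ α, x ∈ A α) → x ∈ A (r x) := fun x hx => csInf_mem (s := {α | x ∈ A α}) hx
  have hLA : ∀ x ∈ L, ∃ α, x ∈ A α := by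
    refine fun x hx => hx {x | ∃ α, x ∈ A α} ?_
    intro x hx
    refine ⟨Order.succ (⨆ z, r z), ?_⟩
    rw [hA]
    refine hH ?_ hx
    intro z hz
    exact ⟨r z, Order.lt_succ_iff.2 (Ordinal.le_iSup r z), hr z hz⟩
  have hAL : ∀ α, A α ⊆ L := by
    intro α
    induction α using WellFoundedLT.induction with
    | _ α ih =>
      rw [hA]
      refine Set.subset_sInter fun Z hZ => Set.Subset.trans (hH ?_) hZ
      rintro z ⟨b, hb, hz⟩
      exact ih b hb hz Z hZ
  refine ⟨r, fun x hx => ?_⟩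
  have h1 := hr x (hLA x hx)
  rw [hA] at h1
  refine hH ?_ h1
  rintro z ⟨b, hb, hz⟩
  exact ⟨hAL b hz, lt_of_le_of_lt (csInf_le' hz) hb⟩

theorem parityWin_of_frequently_top {n : ℕ} (hΩ : ∀ i ≤ n, Ω i ≤ Ω n) (he : Even (Ω n))
    {q : ℕ → ℕ} (hq : ∀ i, q i < n + 1) (hf : ∃ᶠ i in Filter.atTop, q i = n) :
    ParityWin fun i => Ω (q i) :=
  ⟨Ω n, he, hf.mono fun _ hi => congrArg Ω hi,
    Filter.Eventually.of_forall fun i => hΩ _ (Nat.lt_succ_iff.1 (hq i))⟩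

/-- Positional strategies on the solution of a system of equations. -/
theorem exists_strategy_of_sol (hβ : ∀ q, Monotone (β q)) (m : ℕ)
    (hΩ : ∀ i j, i ≤ j → j < m → Ω i ≤ Ω j) (n : ℕ) (hn : n ≤ m) (y : ℕ → Set X) :
    ∃ f : X → ℕ → ℕ → Set X,
      (∀ q < n, ∀ x ∈ sol Ω β n y q, x ∈ β q (f x q) ∧ ∀ k, f x q k ⊆ sol Ω β n y k) ∧
      ∀ (x : ℕ → X) (q : ℕ → ℕ), x 0 ∈ sol Ω β n y (q 0) → (∀ i, q i < n) →
        (∀ i, x (i + 1) ∈ f (x i) (q i) (q (i + 1))) → ParityWin fun i => Ω (q i) := by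
  induction n generalizing y with
  | zero =>
    exact ⟨fun _ _ _ => ∅, fun q hq => absurd hq (Nat.not_lt_zero q),
      fun x q _ hq => absurd (hq 0) (Nat.not_lt_zero _)⟩
  | succ n ih =>
    have hmono : Monotone fun Z => β n (sol Ω β n (Function.update y n Z)) := fun Z Z' hZ =>
      hβ n (sol_mono hβ n (update_le_update_iff.2 ⟨hZ, fun _ _ => le_rfl⟩))
    by_cases he : Even (Ω n)
    · -- greatest fixpoint
      set G := ⋃₀ {Z | Z ⊆ β n (sol Ω β n (Function.update y n Z))} with hG
      have hsol : sol Ω β (n + 1) y = sol Ω β n (Function.update y n G) := by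
        rw [sol, if_pos he]
      rw [hsol]
      have hGn : sol Ω β n (Function.update y n G) n = G := by
        rw [sol_of_le le_rfl, Function.update_self]
      obtain ⟨f, hf1, hf2⟩ := ih (by omega) (Function.update y n G)
      have hfix : G ⊆ β n (sol Ω β n (Function.update y n G)) := by
        refine Set.sUnion_subset fun Z hZ => Set.Subset.trans hZ (hmono ?_)
        exact Set.subset_sUnion_of_mem hZ
      refine ⟨fun x q => if q = n then sol Ω β n (Function.update y n G) else f x q, ?_, ?_⟩
      · intro q hq x hx
        by_cases hqn : q = n
        · subst hqn
          simp only [if_true]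
          rw [hGn] at hx
          exact ⟨hfix hx, fun k => le_rfl⟩
        · simp only [hqn, if_false]
          exact hf1 q (by omega) x hx
      · intro x q h0 hq hp
        have hin : ∀ i, x i ∈ sol Ω β n (Function.update y n G) (q i) := by
          intro i
          induction i with
          | zero => exact h0
          | succ i ihi =>
            have := hp i
            by_cases hqn : q i = n
            · simpa only [hqn, if_true] using this
            · simp only [hqn, if_false] at this
              exact (hf1 (q i) (by have := hq i; omega) (x i) ihi).2 _ this
        by_cases hfr : ∃ᶠ i in Filter.atTop, q i = n
        · exact parityWin_of_frequently_top (fun i hi => hΩ i n hi (by omega)) he hq hfr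
        · rw [Filter.not_frequently, Filter.eventually_atTop] at hfr
          obtain ⟨b, hb⟩ := hfr
          refine parityWin_shift b (hf2 (fun i => x (i + b)) (fun i => q (i + b)) ?_ ?_ ?_)
          · exact hin _
          · intro i
            have h1 := hb (i + b) (by omega)
            have h2 := hq (i + b)
            omega
          · intro i
            have := hp (i + b)
            simp only at this
            rw [if_neg (hb (i + b) (by omega))] at this
            rw [show i + 1 + b = i + b + 1 by omega]
            exact this
    · -- least fixpoint
      set G := ⋂₀ {Z | β n (sol Ω β n (Function.update y n Z)) ⊆ Z} with hG
      have hsol : sol Ω β (n + 1) y = sol Ω β n (Function.update y n G) := by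
        rw [sol, if_neg he]
      rw [hsol]
      obtain ⟨r, hr⟩ := exists_rank_of_lfp hmono
      rw [← hG] at hr
      let Gl : Ordinal.{0} → Set X := fun α => {z | z ∈ G ∧ r z < α}
      let W : Ordinal.{0} → ℕ → Set X := fun α => sol Ω β n (Function.update y n (Gl α))
      have hWn : ∀ α, W α n = Gl α := fun α => by
        simp only [W]; rw [sol_of_le le_rfl, Function.update_self]
      have hGn : sol Ω β n (Function.update y n G) n = G := by
        rw [sol_of_le le_rfl, Function.update_self]
      have hWmono : ∀ α, W α ≤ sol Ω β n (Function.update y n G) := fun α =>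
        sol_mono hβ n (update_le_update_iff.2 ⟨fun z hz => hz.1, fun _ _ => le_rfl⟩)
      have htop : Gl (Order.succ (⨆ z, r z)) = G := by
        ext z
        exact ⟨fun h => h.1, fun h => ⟨h, Order.lt_succ_iff.2 (Ordinal.le_iSup r z)⟩⟩
      let ρ : X → ℕ → Ordinal.{0} := fun x q => if q = n then r x else sInf {α | x ∈ W α q}
      have hρ : ∀ q, q ≠ n → ∀ x ∈ sol Ω β n (Function.update y n G) q, x ∈ W (ρ x q) q := by
        intro q hq x hx
        simp only [ρ, hq, if_false]
        refine csInf_mem (s := {α | x ∈ W α q}) ⟨Order.succ (⨆ z, r z), ?_⟩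
        simp only [W, Set.mem_ofPred_eq, htop]
        exact hx
      have hρle : ∀ q, q ≠ n → ∀ x α, x ∈ W α q → ρ x q ≤ α := by
        intro q hq x α hx
        simp only [ρ, hq, if_false]
        exact csInf_le' hx
      have hρlt : ∀ x α, x ∈ W α n → ρ x n < α := by
        intro x α hx
        rw [hWn] at hx
        simpa [ρ] using hx.2
      choose f hf1 hf2 using fun α => ih (by omega) (Function.update y n (Gl α))
      refine ⟨fun x q => if q = n then W (r x) else f (ρ x q) x q, ?_, ?_⟩
      · intro q hq x hx
        by_cases hqn : q = n
        · subst hqn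
          simp only [if_true]
          rw [hGn] at hx
          exact ⟨hr x hx, hWmono _⟩
        · simp only [hqn, if_false]
          have := hf1 (ρ x q) q (by omega) x (hρ q hqn x hx)
          exact ⟨this.1, fun k => (this.2 k).trans (hWmono _ k)⟩
      · intro x q h0 hq hp
        have hstep : ∀ i, x i ∈ sol Ω β n (Function.update y n G) (q i) →
            x (i + 1) ∈ W (ρ (x i) (q i)) (q (i + 1)) := by
          intro i hi
          have := hp i
          by_cases hqn : q i = n
          · simpa only [hqn, if_true, ρ] using this
          · simp only [hqn, if_false] at this
            exact (hf1 _ (q i) (by have := hq i; omega) (x i) (hρ _ hqn _ hi)).2 _ this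
        have hin : ∀ i, x i ∈ sol Ω β n (Function.update y n G) (q i) := by
          intro i
          induction i with
          | zero => exact h0
          | succ i ihi => exact hWmono _ _ (hstep i ihi)
        have hanti : Antitone fun i => ρ (x i) (q i) := by
          refine antitone_nat_of_succ_le fun i => ?_
          have := hstep i (hin i)
          by_cases hqn : q (i + 1) = n
          · rw [hqn] at this ⊢
            exact (hρlt _ _ this).le
          · exact hρle _ hqn _ _ this
        obtain ⟨b, hb⟩ : ∃ b, ∀ i, b ≤ i → ρ (x b) (q b) = ρ (x i) (q i) := by
          let S := Set.range fun i => ρ (x i) (q i)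
          obtain ⟨b, hb⟩ := csInf_mem (s := S) ⟨_, 0, rfl⟩
          refine ⟨b, fun i hi => le_antisymm ?_ (hanti hi)⟩
          have hb' : ρ (x b) (q b) = sInf S := hb
          rw [hb']
          exact csInf_le' ⟨i, rfl⟩
        have hne : ∀ i, b < i → q i ≠ n := by
          intro i hi hqn
          obtain ⟨j, rfl⟩ : ∃ j, i = j + 1 := ⟨i - 1, by omega⟩
          have := hstep j (hin j)
          rw [hqn] at this
          have := hρlt _ _ this
          rw [← hqn, ← hb j (by omega), ← hb (j + 1) (by omega)] at this
          exact lt_irrefl _ this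
        refine parityWin_shift (b + 1) (hf2 (ρ (x b) (q b)) (fun i => x (i + (b + 1)))
          (fun i => q (i + (b + 1))) ?_ ?_ ?_)
        · have h1 := hρ _ (hne (0 + (b + 1)) (by omega)) _ (hin (0 + (b + 1)))
          rw [← hb _ (by omega)] at h1
          exact h1
        · intro i
          have h1 := hne (i + (b + 1)) (by omega)
          have h2 := hq (i + (b + 1))
          omega
        · intro i
          have := hp (i + (b + 1))
          simp only at this
          rw [if_neg (hne (i + (b + 1)) (by omega)), ← hb _ (by omega)] at this
          rw [show i + 1 + (b + 1) = i + (b + 1) + 1 by omega]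
          exact this

end Sol

/-! ### Parity games on monotone systems -/

section Wins

variable {X Q : Type}

/-- The player for whom the parity condition is to be satisfied has a positional winning strategy
from position `(x₀, q₀)` in the game in which this player chooses, at position `(x, q)`, a family
`U` with `x ∈ β q U`, and the opponent answers with some `k` and some point of `U k`. -/
def Wins (Ω : Q → ℕ) (β : Q → (Q → Set X) → Set X) (x₀ : X) (q₀ : Q) : Prop :=
  ∃ (R : Q → Set X) (f : X → Q → Q → Set X), x₀ ∈ R q₀ ∧
    (∀ q, ∀ x ∈ R q, x ∈ β q (f x q) ∧ ∀ k, f x q k ⊆ R k) ∧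
    ∀ (x : ℕ → X) (q : ℕ → Q), x 0 = x₀ → q 0 = q₀ →
      (∀ i, x (i + 1) ∈ f (x i) (q i) (q (i + 1))) → ParityWin fun i => Ω (q i)

/-- The dual of a system of set operators. -/
def dualSystem {X Q : Type} (β : Q → (Q → Set X) → Set X) : Q → (Q → Set X) → Set X :=
  fun q U => (β q fun k => (U k)ᶜ)ᶜ

theorem dualSystem_mono {β : Q → (Q → Set X) → Set X} (hβ : ∀ q, Monotone (β q)) (q : Q) :
    Monotone (dualSystem β q) := fun _ _ h =>
  Set.compl_subset_compl.2 (hβ q fun k => Set.compl_subset_compl.2 (h k))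

/-- Positions winning for a monotone system are those in the solution of any enumeration of it by
nondecreasing priorities. -/
theorem wins_iff_mem_sol {Ω : Q → ℕ} {β : Q → (Q → Set X) → Set X} {m : ℕ} (e : Q ≃ Fin m)
    {Ω' : ℕ → ℕ} {β' : ℕ → (ℕ → Set X) → Set X} (hβ' : ∀ q, Monotone (β' q))
    (hΩ' : ∀ i j, i ≤ j → j < m → Ω' i ≤ Ω' j) (hΩ : ∀ q, Ω' (e q) = Ω q)
    (hβ : ∀ q U, β' (e q) U = β q fun k => U (e k)) (y : ℕ → Set X) (x₀ : X) (q₀ : Q) :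
    Wins Ω β x₀ q₀ ↔ x₀ ∈ sol Ω' β' m y (e q₀) := by
  constructor
  · rintro ⟨R, f, h0, hf, hw⟩
    by_contra hx
    have hx' : x₀ ∈ sol (fun q => Ω' q + 1) (dualSystem β') m (fun k => (y k)ᶜ) (e q₀) := by
      have := sol_compl (Ω := Ω') (β := β') m y
      unfold dualSystem
      rw [this]
      exact hx
    obtain ⟨g, hg, hgw⟩ := exists_strategy_of_sol (Ω := fun q => Ω' q + 1) (dualSystem_mono hβ') m
      (fun i j hij hj => Nat.succ_le_succ (hΩ' i j hij hj)) m le_rfl (fun k => (y k)ᶜ)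
    set T := sol (fun q => Ω' q + 1) (dualSystem β') m (fun k => (y k)ᶜ) with hT
    have hnext : ∀ p : {p : X × Q // p.1 ∈ R p.2 ∧ p.1 ∈ T (e p.2)},
        ∃ p' : {p : X × Q // p.1 ∈ R p.2 ∧ p.1 ∈ T (e p.2)},
          p'.1.1 ∈ f p.1.1 p.1.2 p'.1.2 ∧ p'.1.1 ∈ g p.1.1 (e p.1.2) (e p'.1.2) := by
      rintro ⟨⟨x, q⟩, hR, hTq⟩
      obtain ⟨h1, h2⟩ := hf q x hR
      obtain ⟨h3, h4⟩ := hg (e q) (e q).2 x hTq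
      by_contra hcon
      refine h3 ?_
      rw [hβ]
      have hm : Monotone (β q) := fun U U' hU => by
        have e1 := hβ q fun n => if h : n < m then U (e.symm ⟨n, h⟩) else ∅
        have e2 := hβ q fun n => if h : n < m then U' (e.symm ⟨n, h⟩) else ∅
        simp only [Fin.is_lt, dite_true, Fin.eta, Equiv.symm_apply_apply] at e1 e2
        rw [← e1, ← e2]
        refine hβ' (e q) fun n => ?_
        by_cases h : n < m
        · simpa [h] using hU _
        · simp [h]
      have hsub : f x q ≤ fun k => (g x (e q) (e k))ᶜ := fun k x' hx' hx'' =>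
        hcon ⟨⟨⟨x', k⟩, h2 k hx', h4 _ hx''⟩, hx', hx''⟩
      exact hm hsub h1
    choose nx hnx1 hnx2 using hnext
    let p : ℕ → {p : X × Q // p.1 ∈ R p.2 ∧ p.1 ∈ T (e p.2)} := fun i =>
      Nat.rec ⟨⟨x₀, q₀⟩, h0, hx'⟩ (fun _ p => nx p) i
    have hw1 := hw (fun i => (p i).1.1) (fun i => (p i).1.2) rfl rfl fun i => hnx1 (p i)
    have hw2 := hgw (fun i => (p i).1.1) (fun i => e (p i).1.2) hx' (fun i => (e _).2)
      fun i => hnx2 (p i)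
    simp only [hΩ] at hw2
    have hfin : Finite Q := Finite.of_equiv _ e.symm
    obtain ⟨b, hb⟩ := (Set.finite_range Ω).bddAbove
    exact (parityWin_succ_iff b fun i => hb ⟨_, rfl⟩).1 hw2 hw1
  · intro hx
    obtain ⟨f, hf, hw⟩ := exists_strategy_of_sol hβ' m hΩ' m le_rfl y
    refine ⟨fun q => sol Ω' β' m y (e q), fun x q k => f x (e q) (e k), hx, ?_, ?_⟩
    · intro q x hxq
      obtain ⟨h1, h2⟩ := hf (e q) (e q).2 x hxq
      rw [hβ] at h1
      exact ⟨h1, fun k => h2 _⟩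
    · intro x q h0 h0' hp
      have := hw x (fun i => e (q i)) (by simpa only [h0, h0'] using hx) (fun i => (e _).2) hp
      simpa only [hΩ] using this

theorem exists_enum_monotone [Finite Q] (Ω : Q → ℕ) :
    ∃ (m : ℕ) (e : Q ≃ Fin m), Monotone (Ω ∘ e.symm) := by
  obtain ⟨m, ⟨e⟩⟩ := Finite.exists_equiv_fin Q
  refine ⟨m, e.trans (Tuple.sort (Ω ∘ e.symm)).symm, ?_⟩
  exact Tuple.monotone_sort (Ω ∘ e.symm)

/-- The extension of a priority function to all natural numbers along an enumeration. -/
def enumPriority {m : ℕ} (e : Q ≃ Fin m) (Ω : Q → ℕ) (n : ℕ) : ℕ :=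
  if h : n < m then Ω (e.symm ⟨n, h⟩) else 0

/-- The extension of a system to all natural numbers along an enumeration. -/
def enumSystem {m : ℕ} (e : Q ≃ Fin m) (β : Q → (Q → Set X) → Set X) (n : ℕ)
    (U : ℕ → Set X) : Set X :=
  if h : n < m then β (e.symm ⟨n, h⟩) (fun k => U (e k)) else ∅

theorem enumPriority_apply {m : ℕ} (e : Q ≃ Fin m) (Ω : Q → ℕ) (q : Q) :
    enumPriority e Ω (e q) = Ω q := by
  simp [enumPriority]

theorem enumPriority_mono {m : ℕ} {e : Q ≃ Fin m} {Ω : Q → ℕ} (h : Monotone (Ω ∘ e.symm))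
    (i j : ℕ) (hij : i ≤ j) (hj : j < m) : enumPriority e Ω i ≤ enumPriority e Ω j := by
  simp only [enumPriority, hj, lt_of_le_of_lt hij hj, dite_true]
  exact h hij

theorem enumSystem_apply {m : ℕ} (e : Q ≃ Fin m) (β : Q → (Q → Set X) → Set X) (q : Q)
    (U : ℕ → Set X) : enumSystem e β (e q) U = β q fun k => U (e k) := by
  simp [enumSystem]

theorem enumSystem_mono {m : ℕ} (e : Q ≃ Fin m) {β : Q → (Q → Set X) → Set X}
    (hβ : ∀ q, Monotone (β q)) (n : ℕ) : Monotone (enumSystem e β n) := by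
  intro U U' h
  unfold enumSystem
  split_ifs
  · exact hβ _ fun k => h _
  · exact le_rfl

/-- Determinacy. -/
theorem not_wins_iff [Finite Q] {Ω : Q → ℕ} {β : Q → (Q → Set X) → Set X}
    (hβ : ∀ q, Monotone (β q)) (x₀ : X) (q₀ : Q) :
    ¬ Wins Ω β x₀ q₀ ↔ Wins (fun q => Ω q + 1) (dualSystem β) x₀ q₀ := by
  obtain ⟨m, e, he⟩ := exists_enum_monotone Ω
  rw [wins_iff_mem_sol e (enumSystem_mono e hβ) (enumPriority_mono he) (enumPriority_apply e Ω)
      (enumSystem_apply e β) (fun _ => ∅),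
    wins_iff_mem_sol e (dualSystem_mono (enumSystem_mono e hβ))
      (fun i j hij hj => Nat.succ_le_succ (enumPriority_mono he i j hij hj))
      (fun q => by rw [enumPriority_apply])
      (fun q U => by simp only [dualSystem, enumSystem_apply]) (fun _ => ∅ᶜ)]
  have := sol_compl (Ω := enumPriority e Ω) (β := enumSystem e β) m (fun _ => ∅)
  unfold dualSystem
  rw [this]
  rfl

end Wins

theorem parityWin_of_shift {a : ℕ → ℕ} (k : ℕ) (h : ParityWin a) :
    ParityWin fun i => a (i + k) := by
  obtain ⟨n, hn, h1, h2⟩ := h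
  refine ⟨n, hn, ?_, ?_⟩
  · rw [Filter.frequently_atTop] at h1 ⊢
    intro b
    obtain ⟨c, hc, hc'⟩ := h1 (b + k)
    refine ⟨c - k, by omega, ?_⟩
    simp only
    rwa [Nat.sub_add_cancel (by omega)]
  · rw [Filter.eventually_atTop] at h2 ⊢
    obtain ⟨b, hb⟩ := h2
    exact ⟨b, fun c hc => hb _ (by omega)⟩

section Wins

variable {X Q : Type}

theorem wins_of_zero {Ω : Q → ℕ} (hΩ : ∀ q, Ω q = 0) {β : Q → (Q → Set X) → Set X} {x₀ : X}
    {q₀ : Q} (hβ : ∀ q, Monotone (β q)) :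
    Wins Ω β x₀ q₀ ↔ ∃ R : Q → Set X, x₀ ∈ R q₀ ∧ ∀ q, R q ⊆ β q R := by
  constructor
  · rintro ⟨R, f, h0, hf, -⟩
    exact ⟨R, h0, fun q x hx => hβ q (hf q x hx).2 (hf q x hx).1⟩
  · rintro ⟨R, h0, hR⟩
    refine ⟨R, fun _ _ => R, h0, fun q x hx => ⟨hR q hx, fun _ => le_rfl⟩, fun x q _ _ _ => ?_⟩
    simp only [hΩ]
    exact ⟨0, Even.zero, Filter.Frequently.of_forall fun _ => rfl,
      Filter.Eventually.of_forall fun _ => le_rfl⟩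

/-- A single positional strategy wins from all winning positions. -/
theorem exists_uniform_strategy [Finite Q] (Ω : Q → ℕ) {β : Q → (Q → Set X) → Set X}
    (hβ : ∀ q, Monotone (β q)) :
    ∃ f : X → Q → Q → Set X,
      (∀ q x, Wins Ω β x q → x ∈ β q (f x q) ∧ ∀ k, ∀ x' ∈ f x q k, Wins Ω β x' k) ∧
      ∀ (x : ℕ → X) (q : ℕ → Q), Wins Ω β (x 0) (q 0) →
        (∀ i, x (i + 1) ∈ f (x i) (q i) (q (i + 1))) → ParityWin fun i => Ω (q i) := by
  obtain ⟨m, e, he⟩ := exists_enum_monotone Ω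
  have hw := fun x q => wins_iff_mem_sol (x₀ := x) (q₀ := q) e (enumSystem_mono e hβ)
    (enumPriority_mono he) (enumPriority_apply e Ω) (enumSystem_apply e β) (fun _ => ∅)
  obtain ⟨f, hf, hp⟩ := exists_strategy_of_sol (enumSystem_mono e hβ) m (enumPriority_mono he) m
    le_rfl (fun _ => ∅)
  refine ⟨fun x q k => f x (e q) (e k), ?_, ?_⟩
  · intro q x hx
    obtain ⟨h1, h2⟩ := hf (e q) (e q).2 x ((hw x q).1 hx)
    rw [enumSystem_apply] at h1
    exact ⟨h1, fun k x' hx' => (hw x' k).2 (h2 _ hx')⟩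
  · intro x q h0 hx
    have := hp x (fun i => e (q i)) ((hw _ _).1 h0) (fun i => (e _).2) hx
    simpa only [enumPriority_apply] using this

theorem wins_unfold [Finite Q] {Ω : Q → ℕ} {β : Q → (Q → Set X) → Set X}
    (hβ : ∀ q, Monotone (β q)) (x₀ : X) (q₀ : Q) :
    Wins Ω β x₀ q₀ ↔ x₀ ∈ β q₀ fun k => {x | Wins Ω β x k} := by
  obtain ⟨f, hf, hp⟩ := exists_uniform_strategy Ω hβ
  constructor
  · intro h
    exact hβ q₀ (hf q₀ x₀ h).2 (hf q₀ x₀ h).1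
  · intro h
    by_contra hn
    refine hn ⟨fun k => {x | Wins Ω β x k ∨ (x = x₀ ∧ k = q₀)},
      fun x q => if x = x₀ ∧ q = q₀ then fun k => {x | Wins Ω β x k} else f x q,
      Or.inr ⟨rfl, rfl⟩, ?_, ?_⟩
    · rintro q x hx
      by_cases hxq : x = x₀ ∧ q = q₀
      · simp only [if_pos hxq]
        obtain ⟨rfl, rfl⟩ := hxq
        exact ⟨h, fun k x' hx' => Or.inl hx'⟩
      · simp only [if_neg hxq]
        have hx' := hf q x (hx.resolve_right hxq)
        exact ⟨hx'.1, fun k x'' h'' => Or.inl (hx'.2 k x'' h'')⟩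
    · intro x q hx0 hq0 hpath
      have hwin : ∀ i, Wins Ω β (x (i + 1)) (q (i + 1)) := by
        intro i
        induction i with
        | zero => simpa [hx0, hq0] using hpath 0
        | succ i ih =>
          have := hpath (i + 1)
          simp only at this
          rw [if_neg (by rintro ⟨h1, h2⟩; rw [h1, h2] at ih; exact hn ih)] at this
          exact (hf _ _ ih).2 _ _ this
      refine parityWin_shift 1 (hp (fun i => x (i + 1)) (fun i => q (i + 1)) (hwin 0) fun i => ?_)
      have := hpath (i + 1)
      simp only at this
      rwa [if_neg (by rintro ⟨h1, h2⟩; have h3 := hwin i; rw [h1, h2] at h3; exact hn h3)] at this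

/-- Embeddings of systems preserve and reflect winning. -/
theorem wins_embed {Q' : Type} {Ω : Q → ℕ} {β : Q → (Q → Set X) → Set X} {Ω' : Q' → ℕ}
    {β' : Q' → (Q' → Set X) → Set X} {g : Q → Q'} (hg : Function.Injective g)
    (hΩ : ∀ q, Ω' (g q) = Ω q) (hβ : ∀ q U, β' (g q) U = β q fun k => U (g k)) (x₀ : X) (q₀ : Q) :
    Wins Ω' β' x₀ (g q₀) ↔ Wins Ω β x₀ q₀ := by
  constructor
  · rintro ⟨R, f, h0, hf, hw⟩
    refine ⟨fun q => R (g q), fun x q k => f x (g q) (g k), h0, fun q x hx => ?_, ?_⟩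
    · have := hf (g q) x hx
      rw [hβ] at this
      exact ⟨this.1, fun k => this.2 _⟩
    · intro x q hx hq hp
      have := hw x (fun i => g (q i)) hx (by simp only [hq]) hp
      simpa only [hΩ] using this
  · rintro ⟨R, f, h0, hf, hw⟩
    refine ⟨fun q' => {x | ∃ q, q' = g q ∧ x ∈ R q},
      fun x q' k' => {x' | ∃ q k, q' = g q ∧ k' = g k ∧ x' ∈ f x q k}, ⟨q₀, rfl, h0⟩, ?_, ?_⟩
    · rintro _ x ⟨q, rfl, hx⟩
      have hfx : (fun k => {x' | ∃ q₁ k₁, g q = g q₁ ∧ g k = g k₁ ∧ x' ∈ f x q₁ k₁}) = f x q := by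
        funext k
        ext x'
        constructor
        · rintro ⟨q₁, k₁, h1, h2, h3⟩
          rwa [hg h1, hg h2]
        · intro h
          exact ⟨q, k, rfl, rfl, h⟩
      refine ⟨?_, ?_⟩
      · rw [hβ, hfx]
        exact (hf q x hx).1
      · rintro _ x' ⟨q₁, k₁, h1, rfl, h3⟩
        rw [← hg h1] at h3
        exact ⟨k₁, rfl, (hf q x hx).2 _ h3⟩
    · intro x q' hx hq hp
      have hq' : ∀ i, ∃ q, q' i = g q := by
        intro i
        obtain ⟨q, k, h, -⟩ := hp i
        exact ⟨q, h⟩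
      choose q hq'' using hq'
      have := hw x q hx (hg (by rw [← hq'', hq])) fun i => by
        obtain ⟨a, b, h1, h2, h3⟩ := hp i
        rw [hq''] at h1 h2
        rwa [hg h1, hg h2]
      simpa only [hq'', hΩ] using this

end Wins

/-! ### Determinization of universal co-Büchi automata on infinite words -/

section Addresses

/-- The characteristic function of a finite set of tokens, in the lexicographic order. -/
noncomputable def lexKey (A : Finset ℕ) : Lex (ℕ → Prop) := toLex fun n => n ∈ A

theorem lexKey_lt_iff {A B : Finset ℕ} :
    lexKey A < lexKey B ↔ ∃ i, (∀ j < i, j ∈ A ↔ j ∈ B) ∧ i ∉ A ∧ i ∈ B := by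
  show (∃ i, (∀ j < i, (j ∈ A) = (j ∈ B)) ∧ (i ∈ A) < (i ∈ B)) ↔ _
  simp only [eq_iff_iff, lt_iff_le_not_ge, le_Prop_eq]
  refine exists_congr fun i => and_congr_right fun _ => ?_
  tauto

theorem lexKey_le_iff {A B : Finset ℕ} :
    lexKey A ≤ lexKey B ↔ ∀ a ∈ A, a ∉ B → ∃ b < a, b ∈ B ∧ b ∉ A := by
  constructor
  · intro h a ha hb
    rcases h.eq_or_lt with h | h
    · have : (a ∈ A) = (a ∈ B) := congrFun h a
      rw [this] at ha
      exact absurd ha hb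
    · obtain ⟨i, h1, h2, h3⟩ := lexKey_lt_iff.1 h
      refine ⟨i, ?_, h3, h2⟩
      rcases lt_trichotomy a i with h4 | rfl | h4
      · exact absurd ((h1 a h4).1 ha) hb
      · exact absurd ha h2
      · exact h4
  · intro h
    by_contra hn
    obtain ⟨i, h1, h2, h3⟩ := lexKey_lt_iff.1 (not_le.1 hn)
    obtain ⟨b, hb, hb1, hb2⟩ := h i h3 h2
    exact hb2 ((h1 b hb).1 hb1)

theorem lexKey_injective : Function.Injective lexKey := by
  intro A B h
  ext a
  exact Iff.of_eq (congrFun h a)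

theorem lexKey_le_of_subset {A B : Finset ℕ} (h : A ⊆ B) : lexKey A ≤ lexKey B :=
  lexKey_le_iff.2 fun _ ha hb => absurd (h ha) hb

theorem lexKey_filter_le {A B : Finset ℕ} (h : lexKey A ≤ lexKey B) (r : ℕ) :
    lexKey (A.filter (· < r)) ≤ lexKey (B.filter (· < r)) := by
  rw [lexKey_le_iff] at h ⊢
  intro a ha hb
  simp only [Finset.mem_filter] at ha hb ⊢
  obtain ⟨b, h1, h2, h3⟩ := h a ha.1 fun h' => hb ⟨h', ha.2⟩
  exact ⟨b, h1, ⟨h2, h1.trans ha.2⟩, fun h' => h3 h'.1⟩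

theorem eventually_const_of_lexKey_mono {B : ℕ → Finset ℕ} {r N : ℕ}
    (hB : ∀ t, ∀ b ∈ B t, b < r) (h : ∀ t ≥ N, lexKey (B t) ≤ lexKey (B (t + 1))) :
    ∃ M ≥ N, ∀ t ≥ M, B t = B M := by
  have hfin : (Set.range fun t => B (N + t)).Finite :=
    ((Finset.range r).powerset.finite_toSet).subset (by
      rintro _ ⟨t, rfl⟩
      simp only [Finset.coe_powerset, Set.mem_preimage, Set.mem_powerset_iff, Finset.coe_subset]
      exact fun b hb => Finset.mem_range.2 (hB _ b hb))
  obtain ⟨_, ⟨t₀, rfl⟩, hmax⟩ := Set.exists_max_image _ lexKey hfin ⟨_, 0, rfl⟩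
  have hm : Monotone fun t => lexKey (B (N + t)) :=
    monotone_nat_of_le_succ fun t => h (N + t) (by omega)
  refine ⟨N + t₀, by omega, fun t ht => ?_⟩
  obtain ⟨s, rfl⟩ : ∃ s, t = N + s := ⟨t - N, by omega⟩
  exact lexKey_injective (le_antisymm (hmax _ ⟨s, rfl⟩) (hm (show t₀ ≤ s by omega)))

variable {P : Type} [Fintype P] (bad : P → Prop) (T : P → P → Prop) (x : P → Finset ℕ)

theorem exists_select : ∃ y : P → Finset ℕ, ∀ p',
    (y p' = ∅ ∨ ∃ p, T p p' ∧ y p' = x p) ∧ ∀ p, T p p' → lexKey (x p) ≤ lexKey (y p') := by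
  refine ⟨fun p' => if h : ∃ p, T p p' then
    x (Classical.choose (Set.exists_max_image {p | T p p'} (fun p => lexKey (x p))
      (Set.toFinite _) h)) else ∅, fun p' => ?_⟩
  by_cases h : ∃ p, T p p'
  · have hc := Classical.choose_spec (Set.exists_max_image {p | T p p'} (fun p => lexKey (x p))
      (Set.toFinite _) h)
    simp only [dif_pos h]
    exact ⟨Or.inr ⟨_, hc.1, rfl⟩, fun p hp => hc.2 p hp⟩
  · simp only [dif_neg h]
    exact ⟨Or.inl trivial, fun p hp => absurd ⟨p, hp⟩ h⟩

/-- The greatest address among those of the predecessors. -/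
noncomputable def selectAddr : P → Finset ℕ := Classical.choose (exists_select T x)

/-- The selected addresses, extended by a fresh token at bad states. -/
noncomputable def growAddr (p : P) : Finset ℕ :=
  if bad p ∧ (selectAddr T x p).Nonempty then
    insert (Fintype.card P + Encodable.encode (selectAddr T x p)) (selectAddr T x p)
  else selectAddr T x p

/-- The token `a` occurs, but never as the last token of an address. -/
def Flash (a : ℕ) : Prop :=
  (∃ p, a ∈ growAddr bad T x p) ∧
    ∀ p, ¬ (a ∈ growAddr bad T x p ∧ ∀ b ∈ growAddr bad T x p, b ≤ a)

/-- Addresses cut off behind flashing tokens. -/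
noncomputable def cutAddr (p : P) : Finset ℕ :=
  (growAddr bad T x p).filter fun a => ∀ s ∈ growAddr bad T x p, Flash bad T x s → a ≤ s

/-- The tokens that occur after cutting. -/
noncomputable def aliveTokens : Finset ℕ := Finset.univ.biUnion (cutAddr bad T x)

/-- Order-preserving renaming of tokens to an initial segment. -/
noncomputable def renameToken (a : ℕ) : ℕ := ((aliveTokens bad T x).filter (· < a)).card

/-- The addresses after one transition. -/
noncomputable def nextAddr (p : P) : Finset ℕ :=
  (cutAddr bad T x p).image (renameToken bad T x)

/-- The event number of a transition: `2 * a` if `a` is the least token that dies, `2 * a + 1` if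
it is the least one that flashes, whichever is smaller. -/
noncomputable def eventNo : ℕ :=
  sInf ({2 * Fintype.card P} ∪ {n | ∃ a, n = 2 * a ∧ (∃ p, a ∈ x p) ∧ a ∉ aliveTokens bad T x} ∪
    {n | ∃ a, n = 2 * a + 1 ∧ Flash bad T x a})

/-- Invariant of the addresses. -/
structure AddrInv (x : P → Finset ℕ) : Prop where
  initial : ∀ p, ∀ a ∈ x p, ∀ b < a, ∃ p', b ∈ x p'
  bounded : ∀ p, ∀ a ∈ x p, a < Fintype.card P
  tree : ∀ p p', ∀ a ∈ x p, a ∈ x p' → ∀ b ∈ x p, b < a → b ∈ x p'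

variable {bad T x}

theorem eventNo_le : eventNo bad T x ≤ 2 * Fintype.card P :=
  Nat.sInf_le (Or.inl (Or.inl rfl))

theorem eventNo_le_of_dead {a : ℕ} {p : P} (h : a ∈ x p) (h' : a ∉ aliveTokens bad T x) :
    eventNo bad T x ≤ 2 * a :=
  Nat.sInf_le (Or.inl (Or.inr ⟨a, rfl, ⟨p, h⟩, h'⟩))

theorem eventNo_le_of_flash {a : ℕ} (h : Flash bad T x a) : eventNo bad T x ≤ 2 * a + 1 :=
  Nat.sInf_le (Or.inr ⟨a, rfl, h⟩)

theorem eventNo_mem : eventNo bad T x = 2 * Fintype.card P ∨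
    (∃ a, eventNo bad T x = 2 * a ∧ (∃ p, a ∈ x p) ∧ a ∉ aliveTokens bad T x) ∨
    ∃ a, eventNo bad T x = 2 * a + 1 ∧ Flash bad T x a := by
  have := Nat.sInf_mem (s := {2 * Fintype.card P} ∪
    {n | ∃ a, n = 2 * a ∧ (∃ p, a ∈ x p) ∧ a ∉ aliveTokens bad T x} ∪
    {n | ∃ a, n = 2 * a + 1 ∧ Flash bad T x a}) ⟨_, Or.inl (Or.inl rfl)⟩
  rcases this with (h | h) | h
  · exact Or.inl h
  · exact Or.inr (Or.inl h)
  · exact Or.inr (Or.inr h)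

theorem selectAddr_spec (p' : P) :
    (selectAddr T x p' = ∅ ∨ ∃ p, T p p' ∧ selectAddr T x p' = x p) ∧
      ∀ p, T p p' → lexKey (x p) ≤ lexKey (selectAddr T x p') :=
  Classical.choose_spec (exists_select T x) p'

theorem exists_pred_of_nonempty {p' : P} (h : (selectAddr T x p').Nonempty) :
    ∃ p, T p p' ∧ selectAddr T x p' = x p :=
  (selectAddr_spec p').1.resolve_left h.ne_empty

theorem selectAddr_subset_growAddr (p : P) : selectAddr T x p ⊆ growAddr bad T x p := by
  unfold growAddr
  split_ifs
  · exact Finset.subset_insert _ _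
  · exact subset_rfl

theorem cutAddr_subset (p : P) : cutAddr bad T x p ⊆ growAddr bad T x p :=
  Finset.filter_subset _ _

theorem mem_selectAddr_of_lt {p : P} {a : ℕ} (h : a ∈ growAddr bad T x p)
    (ha : a < Fintype.card P) : a ∈ selectAddr T x p := by
  unfold growAddr at h
  split_ifs at h
  · rcases Finset.mem_insert.1 h with h | h
    · omega
    · exact h
  · exact h

theorem cutAddr_nonempty {p : P} (h : (growAddr bad T x p).Nonempty) :
    (cutAddr bad T x p).Nonempty := by
  refine ⟨(growAddr bad T x p).min' h, Finset.mem_filter.2 ⟨Finset.min'_mem _ _, ?_⟩⟩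
  exact fun s hs _ => Finset.min'_le _ _ hs

theorem selectAddr_nonempty {p : P} (h : (growAddr bad T x p).Nonempty) :
    (selectAddr T x p).Nonempty := by
  unfold growAddr at h
  split_ifs at h with h'
  · exact h'.2
  · exact h

theorem nextAddr_nonempty_iff {p : P} :
    (nextAddr bad T x p).Nonempty ↔ (selectAddr T x p).Nonempty := by
  rw [nextAddr, Finset.image_nonempty]
  exact ⟨fun h => selectAddr_nonempty (h.mono (cutAddr_subset p)),
    fun h => cutAddr_nonempty (h.mono (selectAddr_subset_growAddr p))⟩

theorem mem_aliveTokens {a : ℕ} : a ∈ aliveTokens bad T x ↔ ∃ p, a ∈ cutAddr bad T x p := by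
  simp [aliveTokens]

theorem renameToken_lt {a b : ℕ} (ha : a ∈ aliveTokens bad T x) (h : a < b) :
    renameToken bad T x a < renameToken bad T x b := by
  refine Finset.card_lt_card ((Finset.ssubset_iff_of_subset ?_).2 ⟨a, ?_, ?_⟩)
  · intro c hc
    rw [Finset.mem_filter] at hc ⊢
    exact ⟨hc.1, hc.2.trans h⟩
  · exact Finset.mem_filter.2 ⟨ha, h⟩
  · simp

theorem renameToken_injOn {a b : ℕ} (ha : a ∈ aliveTokens bad T x) (hb : b ∈ aliveTokens bad T x)
    (h : renameToken bad T x a = renameToken bad T x b) : a = b := by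
  rcases lt_trichotomy a b with h' | h' | h'
  · exact absurd h (renameToken_lt ha h').ne
  · exact h'
  · exact absurd h (renameToken_lt hb h').ne'

theorem renameToken_le (a : ℕ) : renameToken bad T x a ≤ a := by
  refine (Finset.card_le_card (t := Finset.range a) fun b hb => ?_).trans (by simp)
  exact Finset.mem_range.2 (Finset.mem_filter.1 hb).2

theorem renameToken_lt_self {a c : ℕ} (hc : c < a) (h : c ∉ aliveTokens bad T x) :
    renameToken bad T x a < a := by
  refine (Finset.card_lt_card (t := Finset.range a)
    ((Finset.ssubset_iff_of_subset fun b hb => ?_).2 ⟨c, by simpa using hc, ?_⟩)).trans_le (by simp)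
  · exact Finset.mem_range.2 (Finset.mem_filter.1 hb).2
  · exact fun h' => h (Finset.mem_filter.1 h').1

/-- Tokens below which nothing dies keep their names. -/
theorem renameToken_eq_self (hx : AddrInv x) {a : ℕ} {p : P} (ha : a ∈ x p)
    (h : ∀ b < a, (∃ p, b ∈ x p) → b ∈ aliveTokens bad T x) : renameToken bad T x a = a := by
  have : (aliveTokens bad T x).filter (· < a) = Finset.range a := by
    ext b
    simp only [Finset.mem_filter, Finset.mem_range]
    exact ⟨fun h => h.2, fun hb => ⟨h b hb (hx.initial p a ha b hb), hb⟩⟩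
  rw [renameToken, this, Finset.card_range]

/-- Every number below a name in use after the renaming is the name of some token. -/
theorem exists_of_lt_renameToken (a b : ℕ) (h : b < renameToken bad T x a) :
    ∃ c ∈ aliveTokens bad T x, renameToken bad T x c = b := by
  induction a using Nat.strong_induction_on with
  | _ a ih =>
    rcases Nat.eq_zero_or_pos a with rfl | h0
    · simp [renameToken] at h
    · obtain ⟨a, rfl⟩ : ∃ k, a = k + 1 := ⟨a - 1, by omega⟩
      by_cases ha : a ∈ aliveTokens bad T x
      · have hf : (aliveTokens bad T x).filter (· < a + 1) =
            insert a ((aliveTokens bad T x).filter (· < a)) := by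
          ext c
          simp only [Finset.mem_filter, Finset.mem_insert]
          constructor
          · rintro ⟨h1, h2⟩
            by_cases h3 : c = a
            · exact Or.inl h3
            · exact Or.inr ⟨h1, by omega⟩
          · rintro (rfl | ⟨h1, h2⟩)
            · exact ⟨ha, by omega⟩
            · exact ⟨h1, by omega⟩
        rw [renameToken, hf, Finset.card_insert_of_notMem (by simp)] at h
        by_cases hb : b = renameToken bad T x a
        · exact ⟨a, ha, hb.symm⟩
        · refine ih a (by omega) ?_
          rw [renameToken] at hb ⊢
          omega
      · have hf : (aliveTokens bad T x).filter (· < a + 1) =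
            (aliveTokens bad T x).filter (· < a) := by
          ext c
          simp only [Finset.mem_filter]
          constructor
          · rintro ⟨h1, h2⟩
            refine ⟨h1, lt_of_le_of_ne (by omega) ?_⟩
            rintro rfl
            exact ha h1
          · rintro ⟨h1, h2⟩
            exact ⟨h1, by omega⟩
        rw [renameToken, hf] at h
        exact ih a (by omega) h

theorem selectAddr_tree (hx : AddrInv x) {p p' : P} {a : ℕ} (h : a ∈ selectAddr T x p)
    (h' : a ∈ selectAddr T x p') {b : ℕ} (hb : b ∈ selectAddr T x p) (hba : b < a) :
    b ∈ selectAddr T x p' := by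
  obtain ⟨p₁, -, h₁⟩ := exists_pred_of_nonempty ⟨a, h⟩
  obtain ⟨p₂, -, h₂⟩ := exists_pred_of_nonempty ⟨a, h'⟩
  rw [h₁] at h hb
  rw [h₂] at h' ⊢
  exact hx.tree _ _ a h h' b hb hba

theorem selectAddr_lt (hx : AddrInv x) {p : P} {a : ℕ} (h : a ∈ selectAddr T x p) :
    a < Fintype.card P := by
  obtain ⟨p₁, -, h₁⟩ := exists_pred_of_nonempty ⟨a, h⟩
  rw [h₁] at h
  exact hx.bounded _ _ h

theorem growAddr_tree (hx : AddrInv x) {p p' : P} {a : ℕ} (h : a ∈ growAddr bad T x p)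
    (h' : a ∈ growAddr bad T x p') {b : ℕ} (hb : b ∈ growAddr bad T x p) (hba : b < a) :
    b ∈ growAddr bad T x p' := by
  by_cases ha : a < Fintype.card P
  · exact selectAddr_subset_growAddr _ (selectAddr_tree hx (mem_selectAddr_of_lt h ha)
      (mem_selectAddr_of_lt h' ha) (mem_selectAddr_of_lt hb (hba.trans ha)) hba)
  · have key : ∀ p, a ∈ growAddr bad T x p →
        a = Fintype.card P + Encodable.encode (selectAddr T x p) ∧
          growAddr bad T x p = insert a (selectAddr T x p) := by
      intro p h
      unfold growAddr at h ⊢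
      split_ifs at h ⊢
      · rcases Finset.mem_insert.1 h with h | h
        · exact ⟨h, by rw [h]⟩
        · exact absurd (selectAddr_lt hx h) ha
      · exact absurd (selectAddr_lt hx h) ha
    obtain ⟨h1, h2⟩ := key p h
    obtain ⟨h3, h4⟩ := key p' h'
    have : selectAddr T x p = selectAddr T x p' := Encodable.encode_injective (by omega)
    rw [h4, ← this, ← h2]
    exact hb

theorem exists_cutAddr_max (hx : AddrInv x) {a : ℕ} (ha : a ∈ aliveTokens bad T x) :
    ∃ p, a ∈ cutAddr bad T x p ∧ ∀ b ∈ cutAddr bad T x p, b ≤ a := by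
  obtain ⟨p, hp⟩ := mem_aliveTokens.1 ha
  obtain ⟨hp1, hp2⟩ := Finset.mem_filter.1 hp
  by_cases hf : Flash bad T x a
  · exact ⟨p, hp, fun b hb => (Finset.mem_filter.1 hb).2 a hp1 hf⟩
  · obtain ⟨p₀, h1, h2⟩ : ∃ p, a ∈ growAddr bad T x p ∧ ∀ b ∈ growAddr bad T x p, b ≤ a := by
      by_contra hcon
      exact hf ⟨⟨p, hp1⟩, fun p h => hcon ⟨p, h⟩⟩
    refine ⟨p₀, Finset.mem_filter.2 ⟨h1, fun s hs hfs => ?_⟩, fun b hb => h2 b (cutAddr_subset _ hb)⟩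
    by_contra hlt
    exact absurd (hp2 s (growAddr_tree hx h1 hp1 hs (by omega)) hfs) hlt

theorem AddrInv.next (hx : AddrInv x) : AddrInv (nextAddr bad T x) := by
  refine ⟨?_, ?_, ?_⟩
  · intro p a ha b hb
    obtain ⟨c, hc, rfl⟩ := Finset.mem_image.1 ha
    obtain ⟨d, hd, rfl⟩ := exists_of_lt_renameToken _ _ hb
    obtain ⟨p', hp'⟩ := mem_aliveTokens.1 hd
    exact ⟨p', Finset.mem_image_of_mem _ hp'⟩
  · intro p a ha
    obtain ⟨c, hc, rfl⟩ := Finset.mem_image.1 ha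
    have hc' := mem_aliveTokens.2 ⟨p, hc⟩
    have h1 : renameToken bad T x c < (aliveTokens bad T x).card :=
      Finset.card_lt_card ((Finset.ssubset_iff_of_subset (Finset.filter_subset _ _)).2
        ⟨c, hc', by simp⟩)
    refine h1.trans_le ?_
    choose f hf1 hf2 using fun a : aliveTokens bad T x => exists_cutAddr_max hx a.2
    have hinj : Function.Injective f := fun a b hab => Subtype.ext <| le_antisymm
      (hf2 b a (hab ▸ hf1 a)) (hf2 a b (hab ▸ hf1 b))
    simpa using Fintype.card_le_of_injective f hinj
  · intro p p' a ha ha' b hb hba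
    obtain ⟨c, hc, rfl⟩ := Finset.mem_image.1 ha
    obtain ⟨c', hc', h⟩ := Finset.mem_image.1 ha'
    obtain ⟨d, hd, rfl⟩ := Finset.mem_image.1 hb
    have := renameToken_injOn (mem_aliveTokens.2 ⟨_, hc'⟩) (mem_aliveTokens.2 ⟨_, hc⟩) h
    subst this
    have hdc : d < c' := by
      by_contra hcon
      rcases (not_lt.1 hcon).eq_or_lt with h' | h'
      · subst h'
        exact lt_irrefl _ hba
      · exact lt_asymm hba (renameToken_lt (mem_aliveTokens.2 ⟨_, hc⟩) h')
    have hd' := growAddr_tree hx (cutAddr_subset _ hc) (cutAddr_subset _ hc')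
      (cutAddr_subset _ hd) hdc
    refine Finset.mem_image_of_mem _ (Finset.mem_filter.2 ⟨hd', fun s hs hf => ?_⟩)
    exact hdc.le.trans ((Finset.mem_filter.1 hc').2 s hs hf)

end Addresses

/-- An inverse system of nonempty finite sets of states has a thread. -/
theorem exists_thread {P : Type} [Finite P] (Y : ℕ → Set P) (E : ℕ → P → P → Prop)
    (hY : ∀ t, (Y t).Nonempty) (hE : ∀ t, ∀ p' ∈ Y (t + 1), ∃ p ∈ Y t, E t p p') :
    ∃ q : ℕ → P, ∀ t, q t ∈ Y t ∧ E t (q t) (q (t + 1)) := by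
  let Long : ℕ → P → Prop := fun t p => p ∈ Y t ∧ ∀ n, ∃ q : ℕ → P, q 0 = p ∧
    ∀ i < n, q i ∈ Y (t + i) ∧ E (t + i) (q i) (q (i + 1)) ∧ q (i + 1) ∈ Y (t + i + 1)
  have hback : ∀ n t, ∀ p' ∈ Y (t + n), ∃ p ∈ Y t, ∃ q : ℕ → P, q 0 = p ∧
      ∀ i < n, q i ∈ Y (t + i) ∧ E (t + i) (q i) (q (i + 1)) ∧ q (i + 1) ∈ Y (t + i + 1) := by
    intro n
    induction n with
    | zero => exact fun t p' hp' => ⟨p', hp', fun _ => p', rfl, fun i hi => absurd hi (by omega)⟩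
    | succ n ih =>
      intro t p' hp'
      obtain ⟨p, hp, q, h0, hq⟩ := ih (t + 1) p' (by rwa [show t + 1 + n = t + (n + 1) by omega])
      obtain ⟨p₀, hp₀, hE₀⟩ := hE t p hp
      refine ⟨p₀, hp₀, fun i => if i = 0 then p₀ else q (i - 1), by simp, fun i hi => ?_⟩
      rcases Nat.eq_zero_or_pos i with rfl | hi0
      · simpa [h0] using ⟨hp₀, hE₀, hp⟩
      · obtain ⟨j, rfl⟩ : ∃ j, i = j + 1 := ⟨i - 1, by omega⟩
        have := hq j (by omega)
        rw [show t + 1 + j = t + (j + 1) by omega] at this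
        simpa using this
  have hlim : ∀ (t : ℕ) (G : ℕ → P → Prop), (∀ n, ∃ p, G n p) →
      (∀ n k p, n ≤ k → G k p → G n p) → ∃ p, ∀ n, G n p := by
    intro t G h1 h2
    by_contra hcon
    push Not at hcon
    choose N hN using hcon
    obtain ⟨b, hb⟩ := (Set.finite_range N).bddAbove
    obtain ⟨p, hp⟩ := h1 b
    exact hN p (h2 _ _ p (hb ⟨p, rfl⟩) hp)
  have h0 : ∃ p, Long 0 p := by
    obtain ⟨p, hp⟩ := hlim 0 (fun n p => p ∈ Y 0 ∧ ∃ q : ℕ → P, q 0 = p ∧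
      ∀ i < n, q i ∈ Y (0 + i) ∧ E (0 + i) (q i) (q (i + 1)) ∧ q (i + 1) ∈ Y (0 + i + 1))
      (fun n => by
        obtain ⟨p', hp'⟩ := hY (0 + n)
        obtain ⟨p, h1, h2⟩ := hback n 0 p' hp'
        exact ⟨p, h1, h2⟩)
      (fun n k p hnk ⟨h1, q, h2, h3⟩ => ⟨h1, q, h2, fun i hi => h3 i (by omega)⟩)
    exact ⟨p, (hp 0).1, fun n => (hp n).2⟩
  have hs : ∀ t p, Long t p → ∃ p', E t p p' ∧ Long (t + 1) p' := by
    rintro t p ⟨hp, hl⟩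
    obtain ⟨p', hp'⟩ := hlim t (fun n p' => E t p p' ∧ p' ∈ Y (t + 1) ∧ ∃ q : ℕ → P, q 0 = p' ∧
      ∀ i < n, q i ∈ Y (t + 1 + i) ∧ E (t + 1 + i) (q i) (q (i + 1)) ∧
        q (i + 1) ∈ Y (t + 1 + i + 1))
      (fun n => by
        obtain ⟨q, rfl, hq⟩ := hl (n + 1)
        refine ⟨q 1, (hq 0 (by omega)).2.1, (hq 0 (by omega)).2.2, fun i => q (i + 1), rfl,
          fun i hi => ?_⟩
        have := hq (i + 1) (by omega)
        rwa [show t + (i + 1) = t + 1 + i by omega] at this)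
      (fun n k p hnk ⟨h0, h1, q, h2, h3⟩ => ⟨h0, h1, q, h2, fun i hi => h3 i (by omega)⟩)
    exact ⟨p', (hp' 0).1, (hp' 0).2.1, fun n => (hp' n).2.2⟩
  choose nx hnx1 hnx2 using hs
  obtain ⟨p₀, hp₀⟩ := h0
  let q : ∀ t, {p // Long t p} := fun t => Nat.rec ⟨p₀, hp₀⟩ (fun t p => ⟨nx t p.1 p.2, hnx2 t p.1 p.2⟩) t
  exact ⟨fun t => (q t).1, fun t => ⟨(q t).2.1, hnx1 t (q t).1 (q t).2⟩⟩

section Runs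

variable {P : Type} [Fintype P] {bad : P → Prop} {T : ℕ → P → P → Prop} {x : ℕ → P → Finset ℕ}

theorem exists_bad_trace_of_flash (hx : ∀ t, AddrInv (x t))
    (hs : ∀ t, x (t + 1) = nextAddr bad (T t) (x t)) {r : ℕ}
    (hr : 2 * r + 1 ≤ 2 * Fintype.card P)
    (hev : ∀ᶠ t in Filter.atTop, 2 * r + 1 ≤ eventNo bad (T t) (x t))
    (hfr : ∃ᶠ t in Filter.atTop, eventNo bad (T t) (x t) = 2 * r + 1) :
    ∃ q : ℕ → P, (x 0 (q 0)).Nonempty ∧ (∀ t, T t (q t) (q (t + 1))) ∧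
      ∃ᶠ t in Filter.atTop, bad (q t) := by
  obtain ⟨N, hN⟩ := Filter.eventually_atTop.1 hev
  have hflash : ∀ t, eventNo bad (T t) (x t) = 2 * r + 1 → Flash bad (T t) (x t) r := by
    intro t ht
    rcases eventNo_mem (bad := bad) (T := T t) (x := x t) with h | ⟨a, h, -⟩ | ⟨a, h, h'⟩
    · omega
    · omega
    · rwa [show r = a by omega]
  have halive : ∀ t ≥ N, ∀ a ≤ r, (∃ p, a ∈ x t p) → a ∈ aliveTokens bad (T t) (x t) := by
    rintro t ht a ha ⟨p, hp⟩
    by_contra hcon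
    have := eventNo_le_of_dead hp hcon
    have := hN t ht
    omega
  have hnoflash : ∀ t ≥ N, ∀ a < r, ¬ Flash bad (T t) (x t) a := by
    intro t ht a ha hf
    have := eventNo_le_of_flash hf
    have := hN t ht
    omega
  have hfix : ∀ t ≥ N, (∃ p, r ∈ x t p) → renameToken bad (T t) (x t) r = r := by
    rintro t ht ⟨p, hp⟩
    exact renameToken_eq_self (hx t) hp fun b hb h => halive t ht b hb.le h
  have hof_flash : ∀ t, Flash bad (T t) (x t) r → ∃ p, r ∈ x t p := by
    rintro t ⟨⟨p, hp⟩, -⟩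
    have h1 := mem_selectAddr_of_lt hp (by omega)
    obtain ⟨p', -, h2⟩ := exists_pred_of_nonempty ⟨r, h1⟩
    exact ⟨p', h2 ▸ h1⟩
  obtain ⟨M, hM, hMe⟩ := Filter.frequently_atTop.1 hfr N
  have hral : ∀ t ≥ M, ∃ p, r ∈ x t p := by
    intro t ht
    induction t, ht using Nat.le_induction with
    | base => exact hof_flash M (hflash M hMe)
    | succ t ht ih =>
      obtain ⟨p, hp⟩ := mem_aliveTokens.1 (halive t (by omega) r le_rfl ih)
      refine ⟨p, ?_⟩
      rw [hs, nextAddr, ← hfix t (by omega) ih]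
      exact Finset.mem_image_of_mem _ hp
  have hcut : ∀ t ≥ M, ∀ p, r ∈ x (t + 1) p → r ∈ cutAddr bad (T t) (x t) p := by
    intro t ht p hp
    rw [hs, nextAddr] at hp
    obtain ⟨a, ha, har⟩ := Finset.mem_image.1 hp
    rw [← hfix t (by omega) (hral t ht)] at har
    have := renameToken_injOn (mem_aliveTokens.2 ⟨p, ha⟩)
      (halive t (by omega) r le_rfl (hral t ht)) har
    rwa [← this]
  obtain ⟨q, hq⟩ := exists_thread (fun t => {p | (x t p).Nonempty ∧ (M ≤ t → r ∈ x t p)})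
    (fun t p p' => T t p p' ∧ selectAddr (T t) (x t) p' = x t p) (fun t => by
      obtain ⟨p, hp⟩ : ∃ p, (x t p).Nonempty := by
        by_cases ht : M ≤ t
        · obtain ⟨p, hp⟩ := hral t ht
          exact ⟨p, r, hp⟩
        · by_contra hcon
          push Not at hcon
          have : ∀ k, ∀ p, x (t + k) p = ∅ := by
            intro k
            induction k with
            | zero => exact hcon
            | succ k ih =>
              intro p
              by_contra hne
              rw [← add_assoc, hs] at hne
              obtain ⟨p', -, h⟩ := exists_pred_of_nonempty
                (nextAddr_nonempty_iff.1 (Finset.nonempty_iff_ne_empty.2 hne))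
              have h' := nextAddr_nonempty_iff.1 (Finset.nonempty_iff_ne_empty.2 hne)
              rw [h, ih] at h'
              exact Finset.not_nonempty_empty h'
          obtain ⟨p, hp⟩ := hral M le_rfl
          have h' := this (M - t) p
          rw [show t + (M - t) = M by omega] at h'
          rw [h'] at hp
          exact absurd hp (Finset.notMem_empty _)
      by_cases ht : M ≤ t
      · obtain ⟨p, hp⟩ := hral t ht
        exact ⟨p, ⟨r, hp⟩, fun _ => hp⟩
      · exact ⟨p, hp, fun h => absurd h ht⟩)
    (by
      rintro t p' ⟨hne, hp'⟩
      rw [hs] at hne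
      have hne' := nextAddr_nonempty_iff.1 hne
      obtain ⟨p, hp, hsel⟩ := exists_pred_of_nonempty hne'
      refine ⟨p, ⟨hsel ▸ hne', fun ht => ?_⟩, hp, hsel⟩
      rw [← hsel]
      exact mem_selectAddr_of_lt (cutAddr_subset _ (hcut t ht p' (hp' (by omega)))) (by omega))
  refine ⟨q, (hq 0).1.1, fun t => (hq t).2.1, ?_⟩
  rw [Filter.frequently_atTop] at hfr ⊢
  intro b
  obtain ⟨t₁, ht₁, he₁⟩ := hfr (max b M)
  obtain ⟨t₂, ht₂, he₂⟩ := hfr (t₁ + 1)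
  have hb : b ≤ t₁ := (le_max_left _ _).trans ht₁
  have hM₁ : M ≤ t₁ := (le_max_right _ _).trans ht₁
  by_contra hcon
  push Not at hcon
  have hmax : ∀ t, t₁ + 1 ≤ t → ∀ a ∈ x t (q t), a ≤ r := by
    intro t ht
    induction t, ht using Nat.le_induction with
    | base =>
      intro a ha
      have hrc := hcut t₁ hM₁ _ ((hq (t₁ + 1)).1.2 (by omega))
      rw [hs, nextAddr] at ha
      obtain ⟨c, hc, rfl⟩ := Finset.mem_image.1 ha
      exact (renameToken_le c).trans ((Finset.mem_filter.1 hc).2 r (cutAddr_subset _ hrc)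
        (hflash t₁ he₁))
    | succ t ht ih =>
      intro a ha
      rw [hs, nextAddr] at ha
      obtain ⟨c, hc, rfl⟩ := Finset.mem_image.1 ha
      have hc' := cutAddr_subset _ hc
      rw [growAddr, if_neg fun h => hcon (t + 1) (by omega) h.1, (hq t).2.2] at hc'
      exact (renameToken_le c).trans (ih c hc')
  have hf := (hflash t₂ he₂).2 (q (t₂ + 1))
  rw [growAddr, if_neg fun h => hcon (t₂ + 1) (by omega) h.1, (hq t₂).2.2] at hf
  exact hf ⟨(hq t₂).1.2 (by omega), hmax t₂ ht₂⟩

theorem not_bad_trace_of_dead (hx : ∀ t, AddrInv (x t))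
    (hs : ∀ t, x (t + 1) = nextAddr bad (T t) (x t)) {r : ℕ}
    (hev : ∀ᶠ t in Filter.atTop, 2 * r ≤ eventNo bad (T t) (x t))
    (hfr : ∃ᶠ t in Filter.atTop, eventNo bad (T t) (x t) = 2 * r)
    (q : ℕ → P) (h0 : (x 0 (q 0)).Nonempty) (hq : ∀ t, T t (q t) (q (t + 1))) :
    ¬ ∃ᶠ t in Filter.atTop, bad (q t) := by
  intro hbad
  obtain ⟨N, hN⟩ := Filter.eventually_atTop.1 hev
  have hrm : r ≤ Fintype.card P := by
    obtain ⟨t, ht⟩ := hfr.exists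
    have := eventNo_le (bad := bad) (T := T t) (x := x t)
    omega
  have halive : ∀ t ≥ N, ∀ a < r, (∃ p, a ∈ x t p) → a ∈ aliveTokens bad (T t) (x t) := by
    rintro t ht a ha ⟨p, hp⟩
    by_contra hcon
    have := eventNo_le_of_dead hp hcon
    have := hN t ht
    omega
  have hflash : ∀ t ≥ N, ∀ a, Flash bad (T t) (x t) a → r ≤ a := by
    intro t ht a hf
    have := eventNo_le_of_flash hf
    have := hN t ht
    omega
  have hfix : ∀ t ≥ N, ∀ a < r, (∃ p, a ∈ x t p) → renameToken bad (T t) (x t) a = a := by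
    rintro t ht a ha ⟨p, hp⟩
    exact renameToken_eq_self (hx t) hp fun b hb h => halive t ht b (hb.trans ha) h
  have hold : ∀ t ≥ N, ∀ p, ∀ a ∈ growAddr bad (T t) (x t) p, a < r →
      a ∈ selectAddr (T t) (x t) p ∧ a ∈ cutAddr bad (T t) (x t) p ∧
        renameToken bad (T t) (x t) a = a := by
    intro t ht p a ha har
    have h1 := mem_selectAddr_of_lt ha (by omega)
    obtain ⟨p', -, h2⟩ := exists_pred_of_nonempty ⟨a, h1⟩
    refine ⟨h1, Finset.mem_filter.2 ⟨ha, fun s _ hf => ?_⟩, hfix t ht a har ⟨p', h2 ▸ h1⟩⟩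
    have := hflash t ht s hf
    omega
  have hne : ∀ t, (x t (q t)).Nonempty := by
    intro t
    induction t with
    | zero => exact h0
    | succ t ih =>
      rw [hs, nextAddr_nonempty_iff]
      by_contra hcon
      rw [Finset.not_nonempty_iff_eq_empty] at hcon
      have := (selectAddr_spec (T := T t) (x := x t) (q (t + 1))).2 (q t) (hq t)
      rw [hcon, lexKey_le_iff] at this
      obtain ⟨a, ha⟩ := ih
      obtain ⟨b, -, hb, -⟩ := this a ha (Finset.notMem_empty a)
      exact Finset.notMem_empty b hb
  have hsub : ∀ t ≥ N, (selectAddr (T t) (x t) (q (t + 1))).filter (· < r) ⊆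
      (x (t + 1) (q (t + 1))).filter (· < r) := by
    intro t ht a ha
    rw [Finset.mem_filter] at ha ⊢
    obtain ⟨-, h2, h3⟩ := hold t ht _ a (selectAddr_subset_growAddr _ ha.1) ha.2
    refine ⟨?_, ha.2⟩
    rw [hs, nextAddr, ← h3]
    exact Finset.mem_image_of_mem _ h2
  have hle : ∀ t, lexKey ((x t (q t)).filter (· < r)) ≤
      lexKey ((selectAddr (T t) (x t) (q (t + 1))).filter (· < r)) := fun t =>
    lexKey_filter_le ((selectAddr_spec (q (t + 1))).2 (q t) (hq t)) r
  obtain ⟨M, hMN, hM⟩ := eventually_const_of_lexKey_mono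
    (B := fun t => (x t (q t)).filter (· < r)) (r := r) (N := N)
    (fun t b hb => (Finset.mem_filter.1 hb).2)
    (fun t ht => (hle t).trans (lexKey_le_of_subset (hsub t ht)))
  have hsel : ∀ t ≥ M, (selectAddr (T t) (x t) (q (t + 1))).filter (· < r) =
      (x t (q t)).filter (· < r) := by
    intro t ht
    refine lexKey_injective (le_antisymm ?_ (hle t))
    have h1 := lexKey_le_of_subset (hsub t (by omega))
    have h2 := hM t ht
    have h3 := hM (t + 1) (by omega)
    rwa [h3, ← h2] at h1
  -- tokens beyond `r` are not renamed to tokens below `r`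
  have hren : ∀ t ≥ M, ∀ a ∈ cutAddr bad (T t) (x t) (q (t + 1)), r ≤ a →
      r ≤ renameToken bad (T t) (x t) a := by
    intro t ht a ha har
    by_contra hcon
    have h1 : renameToken bad (T t) (x t) a ∈ (x (t + 1) (q (t + 1))).filter (· < r) := by
      rw [Finset.mem_filter, hs, nextAddr]
      exact ⟨Finset.mem_image_of_mem _ ha, by omega⟩
    have h2 := hM t ht
    have h3 := hM (t + 1) (by omega)
    rw [h3, ← h2, ← hsel t ht, Finset.mem_filter] at h1
    obtain ⟨-, h4, h5⟩ := hold t (by omega) _ _ (selectAddr_subset_growAddr _ h1.1) h1.2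
    have h6 := renameToken_injOn (mem_aliveTokens.2 ⟨_, h4⟩) (mem_aliveTokens.2 ⟨_, ha⟩) h5
    omega
  -- the least token beyond `r` stays in place until the renaming
  have hgrow : ∀ t ≥ M, ∀ g ∈ growAddr bad (T t) (x t) (q (t + 1)), r ≤ g →
      ∃ h ∈ cutAddr bad (T t) (x t) (q (t + 1)), r ≤ h ∧ h ≤ g := by
    intro t ht g hg hrg
    have hne : ((growAddr bad (T t) (x t) (q (t + 1))).filter (r ≤ ·)).Nonempty :=
      ⟨g, Finset.mem_filter.2 ⟨hg, hrg⟩⟩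
    have hmem := Finset.mem_filter.1 (Finset.min'_mem _ hne)
    refine ⟨_, Finset.mem_filter.2 ⟨hmem.1, fun s hs' hf => ?_⟩, hmem.2,
      Finset.min'_le _ _ (Finset.mem_filter.2 ⟨hg, hrg⟩)⟩
    exact Finset.min'_le _ _ (Finset.mem_filter.2 ⟨hs', hflash t (by omega) s hf⟩)
  have hstep : ∀ t ≥ M, ∀ g ∈ x t (q t), r ≤ g →
      ∃ h ∈ cutAddr bad (T t) (x t) (q (t + 1)), r ≤ h ∧ h ≤ g := by
    intro t ht g hg hrg
    have h1 := (selectAddr_spec (T := T t) (x := x t) (q (t + 1))).2 (q t) (hq t)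
    by_cases hgy : g ∈ selectAddr (T t) (x t) (q (t + 1))
    · exact hgrow t ht g (selectAddr_subset_growAddr _ hgy) hrg
    · obtain ⟨b, hb, hb1, hb2⟩ := lexKey_le_iff.1 h1 g hg hgy
      have hrb : r ≤ b := by
        by_contra hcon
        have : b ∈ (x t (q t)).filter (· < r) := by
          rw [← hsel t ht]
          exact Finset.mem_filter.2 ⟨hb1, by omega⟩
        exact hb2 (Finset.mem_filter.1 this).1
      obtain ⟨h, h1, h2, h3⟩ := hgrow t ht b (selectAddr_subset_growAddr _ hb1) hrb
      exact ⟨h, h1, h2, by omega⟩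
  have hnext : ∀ t ≥ M, ∀ h ∈ cutAddr bad (T t) (x t) (q (t + 1)), r ≤ h →
      renameToken bad (T t) (x t) h ∈ x (t + 1) (q (t + 1)) ∧
        r ≤ renameToken bad (T t) (x t) h := by
    intro t ht h hh hrh
    refine ⟨?_, hren t ht h hh hrh⟩
    rw [hs, nextAddr]
    exact Finset.mem_image_of_mem _ hh
  obtain ⟨t₀, ht₀, hb₀⟩ := Filter.frequently_atTop.1 hbad (M + 1)
  obtain ⟨t₁, rfl⟩ : ∃ t₁, t₀ = t₁ + 1 := ⟨t₀ - 1, by omega⟩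
  have htail : ∀ t ≥ t₁ + 1, ∃ g ∈ x t (q t), r ≤ g := by
    intro t ht
    induction t, ht using Nat.le_induction with
    | base =>
      have hy : (selectAddr (T t₁) (x t₁) (q (t₁ + 1))).Nonempty := by
        rw [← nextAddr_nonempty_iff (bad := bad), ← hs]
        exact hne _
      obtain ⟨h, h1, h2, -⟩ := hgrow t₁ (by omega)
        (Fintype.card P + Encodable.encode (selectAddr (T t₁) (x t₁) (q (t₁ + 1))))
        (by rw [growAddr, if_pos ⟨hb₀, hy⟩]; exact Finset.mem_insert_self _ _) (by omega)
      exact ⟨_, hnext t₁ (by omega) h h1 h2⟩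
    | succ t ht ih =>
      obtain ⟨g, hg, hrg⟩ := ih
      obtain ⟨h, h1, h2, -⟩ := hstep t (by omega) g hg hrg
      exact ⟨_, hnext t (by omega) h h1 h2⟩
  obtain ⟨g, ⟨t₂, ht₂, hg, hrg⟩, hmin⟩ : ∃ g, (∃ t ≥ t₁ + 1, g ∈ x t (q t) ∧ r ≤ g) ∧
      ∀ g', (∃ t ≥ t₁ + 1, g' ∈ x t (q t) ∧ r ≤ g') → g ≤ g' := by
    have hex : ∃ g, ∃ t ≥ t₁ + 1, g ∈ x t (q t) ∧ r ≤ g := by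
      obtain ⟨g, hg⟩ := htail (t₁ + 1) le_rfl
      exact ⟨g, t₁ + 1, le_rfl, hg⟩
    exact ⟨Nat.find hex, Nat.find_spec hex, fun g' hg' => Nat.find_min' hex hg'⟩
  have hstay : ∀ t ≥ t₂, g ∈ x t (q t) := by
    intro t ht
    induction t, ht using Nat.le_induction with
    | base => exact hg
    | succ t ht ih =>
      obtain ⟨h, h1, h2, h3⟩ := hstep t (by omega) g ih hrg
      obtain ⟨h4, h5⟩ := hnext t (by omega) h h1 h2
      have h6 := hmin _ ⟨t + 1, by omega, h4, h5⟩
      have h7 := renameToken_le (bad := bad) (T := T t) (x := x t) h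
      rwa [show renameToken bad (T t) (x t) h = g by omega] at h4
  have hgm := (hx t₂).bounded _ _ hg
  obtain ⟨t₃, ht₃, he⟩ := Filter.frequently_atTop.1 hfr t₂
  rcases eventNo_mem (bad := bad) (T := T t₃) (x := x t₃) with h | ⟨a, h, h', h''⟩ | ⟨a, h, -⟩
  · omega
  · obtain rfl : a = r := by omega
    obtain ⟨h, h1, h2, h3⟩ := hstep t₃ (by omega) g (hstay t₃ ht₃) hrg
    obtain ⟨h4, h5⟩ := hnext t₃ (by omega) h h1 h2
    have h6 := hmin _ ⟨t₃ + 1, by omega, h4, h5⟩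
    have h7 : a ≠ h := by
      rintro rfl
      exact h'' (mem_aliveTokens.2 ⟨_, h1⟩)
    have h8 := renameToken_lt_self (a := h) (lt_of_le_of_ne h2 h7) h''
    omega
  · omega

end Runs

section Determinization

/-- The run of a deterministic transition function. -/
def detRun {D A : Type} (step : D → A → D) (d₀ : D) (w : ℕ → A) : ℕ → D
  | 0 => d₀
  | i + 1 => step (detRun step d₀ w i) (w i)

/-- Universal co-Büchi automata are equivalent to deterministic parity automata. -/
theorem exists_determinization_coBuchi {P A : Type} [Finite P] (bad : P → Prop) (p₀ : P)
    (T : A → P → P → Prop) :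
    ∃ (D : Type) (_ : Finite D) (d₀ : D) (step : D → A → D) (pr : D → ℕ), ∀ w : ℕ → A,
      (∀ q : ℕ → P, q 0 = p₀ → (∀ i, T (w i) (q i) (q (i + 1))) →
        ¬ ∃ᶠ i in Filter.atTop, bad (q i)) ↔
      ParityWin fun i => pr (detRun step d₀ w i) := by
  have := Fintype.ofFinite P
  have hcard : 0 < Fintype.card P := Fintype.card_pos_iff.2 ⟨p₀⟩
  let x₀ : P → Finset ℕ := fun p => if p = p₀ then {0} else ∅
  have hx₀ : AddrInv x₀ := by
    have h : ∀ p, ∀ a ∈ x₀ p, a = 0 := by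
      intro p a ha
      by_cases hp : p = p₀
      · simpa [x₀, hp] using ha
      · simp [x₀, hp] at ha
    refine ⟨fun p a ha b hb => ?_, fun p a ha => ?_, fun p p' a ha _ b _ hb => ?_⟩
    · rw [h p a ha] at hb; omega
    · rw [h p a ha]; exact hcard
    · rw [h p a ha] at hb; omega
  let D := {x : P → Finset ℕ // AddrInv x} × Fin (2 * Fintype.card P + 1)
  have hfin : Finite {x : P → Finset ℕ // AddrInv x} := by
    have : Finite (P → {A : Finset ℕ // A ⊆ Finset.range (Fintype.card P)}) := by
      have : Finite {A : Finset ℕ // A ⊆ Finset.range (Fintype.card P)} :=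
        ((Finset.range (Fintype.card P)).powerset.finite_toSet.subset
          (fun A hA => Finset.mem_coe.2 (Finset.mem_powerset.2 hA)) : Set.Finite {A | A ⊆ Finset.range (Fintype.card P)})
      infer_instance
    refine Finite.of_injective (β := P → {A : Finset ℕ // A ⊆ Finset.range (Fintype.card P)})
      (fun x p => ⟨x.1 p, fun a ha => Finset.mem_range.2 (x.2.bounded p a ha)⟩) ?_
    intro x y h
    apply Subtype.ext
    funext p
    exact congrArg Subtype.val (congrFun h p)
  let step : D → A → D := fun d a => (⟨nextAddr bad (T a) d.1.1, d.1.2.next⟩,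
    ⟨eventNo bad (T a) d.1.1, Nat.lt_succ_iff.2 eventNo_le⟩)
  let pr : D → ℕ := fun d => 2 * Fintype.card P - d.2
  refine ⟨D, inferInstance, (⟨x₀, hx₀⟩, 0), step, pr, fun w => ?_⟩
  set run := detRun step (⟨x₀, hx₀⟩, 0) w with hrun
  let x : ℕ → P → Finset ℕ := fun t => (run t).1.1
  let e : ℕ → ℕ := fun t => eventNo bad (T (w t)) (x t)
  have hxi : ∀ t, AddrInv (x t) := fun t => (run t).1.2
  have hs : ∀ t, x (t + 1) = nextAddr bad (T (w t)) (x t) := fun t => rfl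
  have he : ∀ t, pr (run (t + 1)) = 2 * Fintype.card P - e t := fun t => rfl
  have hle : ∀ t, e t ≤ 2 * Fintype.card P := fun t => eventNo_le
  have hx0 : ∀ p, (x 0 p).Nonempty ↔ p = p₀ := by
    intro p
    by_cases hp : p = p₀
    · simp [x, hrun, detRun, x₀, hp]
    · simp [x, hrun, detRun, x₀, hp]
  obtain ⟨n, hn1, hn2⟩ := exists_limsup_of_bounded (fun t => pr (run (t + 1)))
    (2 * Fintype.card P) fun t => Nat.sub_le _ _
  have hnm : n ≤ 2 * Fintype.card P := by
    obtain ⟨t, ht⟩ := hn1.exists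
    rw [← ht]
    exact Nat.sub_le _ _
  have hfr : ∀ k, n + k = 2 * Fintype.card P → ∃ᶠ t in Filter.atTop, e t = k := fun k hk =>
    hn1.mono fun t ht => by
      have := he t
      have := hle t
      omega
  have hev : ∀ k, n + k = 2 * Fintype.card P → ∀ᶠ t in Filter.atTop, k ≤ e t := fun k hk =>
    hn2.mono fun t ht => by
      have := he t
      have := hle t
      omega
  constructor
  · intro h
    by_contra hn
    have hodd : ¬ Even n := fun h' => hn (parityWin_shift 1 ⟨n, h', hn1, hn2⟩)
    obtain ⟨r, rfl⟩ := Nat.not_even_iff_odd.1 hodd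
    have hk : 2 * r + 1 + (2 * (Fintype.card P - r - 1) + 1) = 2 * Fintype.card P := by omega
    obtain ⟨q, h0, hq, hb⟩ := exists_bad_trace_of_flash hxi hs (by omega) (hev _ hk) (hfr _ hk)
    exact h q ((hx0 _).1 h0) hq hb
  · intro h q h0 hq
    obtain ⟨n', he', h1, h2⟩ := parityWin_of_shift 1 h
    obtain rfl := limsup_unique h1 h2 hn1 hn2
    obtain ⟨r, rfl⟩ := he'
    have hk : r + r + 2 * (Fintype.card P - r) = 2 * Fintype.card P := by omega
    exact not_bad_trace_of_dead hxi hs (hev _ hk) (hfr _ hk) q ((hx0 _).2 h0) hq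

/-- The transitions of the co-Büchi automaton guessing the limit superior of the priorities. -/
def guessStep {Q : Type} (Ω : Q → ℕ) (W : Set (Q × Q)) : Q ⊕ Q × Q → Q ⊕ Q × Q → Prop
  | .inl q, .inl q' => (q, q') ∈ W
  | .inl q, .inr (q', g) => (q, q') ∈ W ∧ Ω q' ≤ Ω g ∧ ¬ Even (Ω g)
  | .inr _, .inl _ => False
  | .inr (q, g), .inr (q', g') => (q, q') ∈ W ∧ Ω q' ≤ Ω g ∧ g' = g

/-- States of the guessing automaton at which the guess is attained. -/
def guessBad {Q : Type} (Ω : Q → ℕ) : Q ⊕ Q × Q → Prop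
  | .inl _ => False
  | .inr (q, g) => Ω q = Ω g

theorem exists_guess_trace_iff {Q : Type} [Finite Q] (Ω : Q → ℕ) (q₀ : Q) (w : ℕ → Set (Q × Q)) :
    (∀ q : ℕ → Q, q 0 = q₀ → (∀ i, (q i, q (i + 1)) ∈ w i) → ParityWin fun i => Ω (q i)) ↔
      ∀ p : ℕ → Q ⊕ Q × Q, p 0 = .inl q₀ → (∀ i, guessStep Ω (w i) (p i) (p (i + 1))) →
        ¬ ∃ᶠ i in Filter.atTop, guessBad Ω (p i) := by
  constructor
  · intro h p h0 hp hbad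
    let q : ℕ → Q := fun i => match p i with
      | .inl q => q
      | .inr (q, _) => q
    have hq : ∀ i, (q i, q (i + 1)) ∈ w i := by
      intro i
      have := hp i
      simp only [q]
      rcases h1 : p i with a | ⟨a, g⟩ <;> rcases h2 : p (i + 1) with b | ⟨b, g'⟩ <;>
        rw [h1, h2] at this
      · exact this
      · exact this.1
      · exact this.elim
      · exact this.1
    have hw := h q (by simp only [q, h0]) hq
    obtain ⟨N, hN⟩ := hbad.exists
    rcases hpN : p N with a | ⟨a, g⟩
    · rw [hpN] at hN; exact hN
    · have hodd : ∀ i b g, p i = .inr (b, g) → ¬ Even (Ω g) := by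
        intro i
        induction i with
        | zero => intro b g hb; rw [h0] at hb; cases hb
        | succ i ih =>
          intro b g hb
          have := hp i
          rcases h1 : p i with c | ⟨c, g'⟩ <;> rw [h1, hb] at this
          · exact this.2.2
          · rw [this.2.2]; exact ih c g' h1
      have hstay : ∀ i ≥ N, ∃ b, p i = .inr (b, g) ∧ (i = N ∨ Ω b ≤ Ω g) := by
        intro i hi
        induction i, hi using Nat.le_induction with
        | base => exact ⟨a, hpN, Or.inl rfl⟩
        | succ i hi ih =>
          obtain ⟨b, hb, -⟩ := ih
          have := hp i
          rcases h1 : p (i + 1) with c | ⟨c, g'⟩ <;> rw [h1, hb] at this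
          · exact this.elim
          · obtain ⟨-, h2, rfl⟩ := this
            exact ⟨c, rfl, Or.inr h2⟩
      obtain ⟨n, hn, h1, h2⟩ := hw
      have : n = Ω g := by
        refine limsup_unique h1 h2 ?_ ?_
        · rw [Filter.frequently_atTop] at hbad ⊢
          intro b
          obtain ⟨c, hc, hc'⟩ := hbad (max b N)
          obtain ⟨d, hd, -⟩ := hstay c ((le_max_right _ _).trans hc)
          refine ⟨c, (le_max_left _ _).trans hc, ?_⟩
          rw [hd] at hc'
          simp only [q, hd]
          exact hc'
        · rw [Filter.eventually_atTop]
          refine ⟨N + 1, fun c hc => ?_⟩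
          obtain ⟨d, hd, hd'⟩ := hstay c (by omega)
          simp only [q, hd]
          exact hd'.resolve_left (by omega)
      exact hodd N a g hpN (this ▸ hn)
  · intro h q h0 hq
    by_contra hn
    obtain ⟨b, hb⟩ := (Set.finite_range Ω).bddAbove
    obtain ⟨n, hn1, hn2⟩ := exists_limsup_of_bounded (fun i => Ω (q i)) b fun i => hb ⟨_, rfl⟩
    have hodd : ¬ Even n := fun h' => hn ⟨n, h', hn1, hn2⟩
    obtain ⟨N, hN⟩ := Filter.eventually_atTop.1 hn2
    obtain ⟨M, -, rfl⟩ := Filter.frequently_atTop.1 hn1 0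
    refine h (fun i => if i ≤ N then .inl (q i) else .inr (q i, q M)) (by simp [h0]) ?_ ?_
    · intro i
      rcases lt_trichotomy i N with h1 | h1 | h1
      · simp only [if_pos h1.le, if_pos (Nat.succ_le_of_lt h1)]
        exact hq i
      · simp only [if_pos h1.le, if_neg (show ¬ i + 1 ≤ N by omega)]
        exact ⟨hq i, hN (i + 1) (by omega), hodd⟩
      · simp only [if_neg (show ¬ i ≤ N by omega), if_neg (show ¬ i + 1 ≤ N by omega)]
        exact ⟨hq i, hN (i + 1) (by omega), rfl⟩
    · rw [Filter.frequently_atTop] at hn1 ⊢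
      intro b
      obtain ⟨c, hc, hc'⟩ := hn1 (max b (N + 1))
      have := (le_max_right b (N + 1)).trans hc
      refine ⟨c, (le_max_left _ _).trans hc, ?_⟩
      simp only [if_neg (show ¬ c ≤ N by omega)]
      exact hc'

/-- Universal parity automata reading relations are equivalent to deterministic ones. -/
theorem exists_determinization {Q : Type} [Finite Q] (Ω : Q → ℕ) (q₀ : Q) :
    ∃ (D : Type) (_ : Finite D) (d₀ : D) (step : D → Set (Q × Q) → D) (pr : D → ℕ),
      ∀ w : ℕ → Set (Q × Q),
        (∀ q : ℕ → Q, q 0 = q₀ → (∀ i, (q i, q (i + 1)) ∈ w i) → ParityWin fun i => Ω (q i)) ↔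
        ParityWin fun i => pr (detRun step d₀ w i) := by
  obtain ⟨D, hD, d₀, step, pr, h⟩ :=
    exists_determinization_coBuchi (guessBad Ω) (.inl q₀) (guessStep Ω)
  exact ⟨D, hD, d₀, step, pr, fun w => (exists_guess_trace_iff Ω q₀ w).trans (h w)⟩

end Determinization

/-! ### Automata for second-order formulas -/

/-- Parity automata for one-step structures: a set `D` of successors with a family of subsets
(the blocks), together with a set of proposition letters. -/
structure Aut where
  Q : Type
  fin : Finite Q
  Ω : Q → ℕ
  init : Q
  bd : ℕ
  δ : (D : Type) → Set (Set D) → Set ℕ → Q → (Q → Set D) → Prop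
  transfer : ∀ {D D' : Type} (e : D ≃ D') (𝔅 : Set (Set D)) (𝔅' : Set (Set D')),
    (∀ B', B' ∈ 𝔅' ↔ e ⁻¹' B' ∈ 𝔅) → ∀ col col' : Set ℕ, (∀ p < bd, p ∈ col ↔ p ∈ col') →
    ∀ (q : Q) (U : Q → Set D) (U' : Q → Set D'), (∀ k, ∀ d ∈ U k, e d ∈ U' k) →
    δ D 𝔅 col q U → δ D' 𝔅' col' q U'

attribute [instance] Aut.fin

namespace Aut

variable {X D : Type}

/-- The system of set operators induced by an automaton on a family of one-step structures. -/
def system (A : Aut) (next : X → D → X) (𝔅 : X → Set (Set D)) (col : X → Set ℕ) :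
    A.Q → (A.Q → Set X) → Set X :=
  fun q U => {x | A.δ D (𝔅 x) (col x) q fun k => {d | next x d ∈ U k}}

theorem system_mono (A : Aut) (next : X → D → X) (𝔅 : X → Set (Set D)) (col : X → Set ℕ)
    (q : A.Q) : Monotone (A.system next 𝔅 col q) := fun _ _ h x hx =>
  A.transfer (Equiv.refl D) (𝔅 x) (𝔅 x) (fun _ => Iff.rfl) _ _ (fun _ _ => Iff.rfl) q _ _
    (fun k _ hd => h k hd) hx

/-- Acceptance of a position. -/
def Acc (A : Aut) (next : X → D → X) (𝔅 : X → Set (Set D)) (col : X → Set ℕ) (x : X) : Prop :=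
  Wins A.Ω (A.system next 𝔅 col) x A.init

end Aut

/-- The neighborhood function on finite sequences induced by blocks of successors. -/
def treeNbhd {D : Type} (𝔅 : List D → Set (Set D)) (c : List D) : MObj (List D) :=
  ⟨{Z | ∃ B ∈ 𝔅 c, ∀ d ∈ B, d :: c ∈ Z}, fun _ _ ⟨B, hB, h⟩ hZ => ⟨B, hB, fun d hd => hZ (h d hd)⟩⟩

/-- The automaton accepts the tree given by blocks `𝔅` and valuation `V`. -/
def Aut.AccTree (A : Aut) {D : Type} (𝔅 : List D → Set (Set D)) (V : ℕ → Set (List D)) : Prop :=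
  A.Acc (fun c d => d :: c) 𝔅 (fun c => {p | c ∈ V p}) []

namespace Aut

/-- Automaton for `sr p`. -/
def single (p : ℕ) : Aut where
  Q := Bool
  fin := inferInstance
  Ω _ := 0
  init := true
  bd := p + 1
  δ _ _ col q U := (p ∈ col ↔ q = true) ∧ ∀ d, d ∈ U false
  transfer e _ _ _ _ _ hcol _ _ _ hU h :=
    ⟨(hcol p (Nat.lt_succ_self p)).symm.trans h.1, fun d => by
      simpa using hU false _ (h.2 (e.symm d))⟩

theorem single_acc (p : ℕ) {D : Type} (𝔅 : List D → Set (Set D)) (V : ℕ → Set (List D)) :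
    (single p).AccTree 𝔅 V ↔ V p = {[]} := by
  unfold AccTree Acc
  refine (wins_of_zero (Ω := (single p).Ω) (fun _ => rfl) (system_mono _ _ _ _)).trans ?_
  constructor
  · rintro ⟨R, h0, hR⟩
    have hf : ∀ c, c ≠ [] → c ∈ R false := by
      intro c hc
      induction c with
      | nil => exact absurd rfl hc
      | cons d c ih =>
        rcases eq_or_ne c [] with rfl | hc'
        · exact (hR true h0).2 d
        · exact (hR false (ih hc')).2 d
    ext c
    rcases eq_or_ne c [] with rfl | hc
    · exact iff_of_true ((hR true h0).1.2 rfl) rfl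
    · exact iff_of_false (fun h => Bool.false_ne_true ((hR false (hf c hc)).1.1 h)) hc
  · intro h
    refine ⟨fun q => {c | c = [] ↔ q = true}, by simp; rfl, ?_⟩
    intro q c hc
    refine ⟨?_, fun d => ?_⟩
    · show c ∈ V p ↔ q = true
      rw [h]
      exact hc
    · simp

/-- Automaton for `p ⊆ q`. -/
def incl (p q : ℕ) : Aut where
  Q := Unit
  fin := inferInstance
  Ω _ := 0
  init := ()
  bd := p + q + 1
  δ _ _ col _ U := (p ∈ col → q ∈ col) ∧ ∀ d, d ∈ U ()
  transfer e _ _ _ _ _ hcol _ _ _ hU h :=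
    ⟨fun h' => (hcol q (by omega)).1 (h.1 ((hcol p (by omega)).2 h')), fun d => by
      simpa using hU () _ (h.2 (e.symm d))⟩

theorem incl_acc (p q : ℕ) {D : Type} (𝔅 : List D → Set (Set D)) (V : ℕ → Set (List D)) :
    (incl p q).AccTree 𝔅 V ↔ V p ⊆ V q := by
  unfold AccTree Acc
  refine (wins_of_zero (Ω := (incl p q).Ω) (fun _ => rfl) (system_mono _ _ _ _)).trans ?_
  constructor
  · rintro ⟨R, h0, hR⟩ c
    have hc : c ∈ R () := by
      induction c with
      | nil => exact h0
      | cons d c ih => exact (hR () ih).2 d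
    exact (hR () hc).1
  · intro h
    exact ⟨fun _ => Set.univ, trivial, fun _ c _ => ⟨fun h' => h h', fun _ => trivial⟩⟩

/-- Automaton for `□(p, q)`. -/
def boxAut (p q : ℕ) : Aut where
  Q := Bool
  fin := inferInstance
  Ω _ := 0
  init := true
  bd := p + q + 1
  δ _ 𝔅 col k U := (k = true → (∀ d, d ∈ U true) ∧ (p ∈ col → ∃ B ∈ 𝔅, B ⊆ U false)) ∧
    (k = false → q ∈ col)
  transfer e 𝔅 𝔅' h𝔅 _ _ hcol _ U U' hU h := by
    refine ⟨fun hk => ⟨fun d => by simpa using hU true _ ((h.1 hk).1 (e.symm d)), fun hp => ?_⟩,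
      fun hk => (hcol q (by omega)).1 (h.2 hk)⟩
    obtain ⟨B, hB, hBU⟩ := (h.1 hk).2 ((hcol p (by omega)).2 hp)
    refine ⟨e.symm ⁻¹' B, (h𝔅 _).2 (by simpa [Set.preimage_preimage] using hB), fun d hd => ?_⟩
    simpa using hU false _ (hBU hd)

theorem boxAut_acc (p q : ℕ) {D : Type} (𝔅 : List D → Set (Set D)) (V : ℕ → Set (List D)) :
    (boxAut p q).AccTree 𝔅 V ↔ ∀ v ∈ V p, ∃ Z ∈ (treeNbhd 𝔅 v).1, Z ⊆ V q := by
  unfold AccTree Acc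
  refine (wins_of_zero (Ω := (boxAut p q).Ω) (fun _ => rfl) (system_mono _ _ _ _)).trans ?_
  constructor
  · rintro ⟨R, h0, hR⟩ c hcp
    have hc : c ∈ R true := by
      clear hcp
      induction c with
      | nil => exact h0
      | cons d c ih => exact ((hR true ih).1 rfl).1 d
    obtain ⟨B, hB, hBR⟩ := ((hR true hc).1 rfl).2 hcp
    exact ⟨V q, ⟨B, hB, fun d hd => (hR false (hBR hd)).2 rfl⟩, subset_rfl⟩
  · intro h
    refine ⟨fun k => {c | k = false → c ∈ V q}, ?_, fun k c hc => ⟨fun _ => ⟨?_, ?_⟩, hc⟩⟩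
    · exact fun h => (Bool.false_ne_true h.symm).elim
    · exact fun d h => (Bool.false_ne_true h.symm).elim
    · intro hp
      obtain ⟨Z, ⟨B, hB, hBZ⟩, hZ⟩ := h c hp
      exact ⟨B, hB, fun d hd _ => hZ (hBZ d hd)⟩

/-- Complement automaton. -/
def compl (A : Aut) : Aut where
  Q := A.Q
  fin := A.fin
  Ω q := A.Ω q + 1
  init := A.init
  bd := A.bd
  δ D 𝔅 col q U := ¬ A.δ D 𝔅 col q fun k => (U k)ᶜ
  transfer e 𝔅 𝔅' h𝔅 col col' hcol q U U' hU h h' := by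
    refine h (A.transfer e.symm 𝔅' 𝔅 (fun B => ?_) col' col (fun p hp => (hcol p hp).symm) q
      (fun k => (U' k)ᶜ) (fun k => (U k)ᶜ) (fun k d hd hd' => hd ?_) h')
    · rw [h𝔅, ← Set.preimage_comp]
      simp
    · simpa using hU k _ hd'

theorem compl_acc (A : Aut) {D : Type} (𝔅 : List D → Set (Set D)) (V : ℕ → Set (List D)) :
    A.compl.AccTree 𝔅 V ↔ ¬ A.AccTree 𝔅 V :=
  (not_wins_iff (A.system_mono _ _ _) _ _).symm

/-- Union automaton. -/
def sum (A B : Aut) : Aut where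
  Q := Option (A.Q ⊕ B.Q)
  fin := inferInstance
  Ω o := o.elim 0 (Sum.elim A.Ω B.Ω)
  init := none
  bd := max A.bd B.bd
  δ D 𝔅 col
    | none, U => A.δ D 𝔅 col A.init (fun k => U (some (.inl k))) ∨
        B.δ D 𝔅 col B.init (fun k => U (some (.inr k)))
    | some (.inl q), U => A.δ D 𝔅 col q (fun k => U (some (.inl k)))
    | some (.inr q), U => B.δ D 𝔅 col q (fun k => U (some (.inr k)))
  transfer e 𝔅 𝔅' h𝔅 col col' hcol q U U' hU h := by
    have hA := fun q => A.transfer e 𝔅 𝔅' h𝔅 col col'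
      (fun p hp => hcol p (hp.trans_le (le_max_left _ _))) q _ _ fun k => hU (some (.inl k))
    have hB := fun q => B.transfer e 𝔅 𝔅' h𝔅 col col'
      (fun p hp => hcol p (hp.trans_le (le_max_right _ _))) q _ _ fun k => hU (some (.inr k))
    match q, h with
    | none, h => exact h.imp (hA _) (hB _)
    | some (.inl q), h => exact hA q h
    | some (.inr q), h => exact hB q h

theorem sum_acc (A B : Aut) {D : Type} (𝔅 : List D → Set (Set D)) (V : ℕ → Set (List D)) :
    (A.sum B).AccTree 𝔅 V ↔ A.AccTree 𝔅 V ∨ B.AccTree 𝔅 V := by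
  have hA : ∀ c q, Wins (A.sum B).Ω ((A.sum B).system (fun c d => d :: c) 𝔅 fun c => {p | c ∈ V p})
      c (some (Sum.inl q) : Option (A.Q ⊕ B.Q)) ↔ Wins A.Ω (A.system (fun c d => d :: c) 𝔅 fun c => {p | c ∈ V p}) c q :=
    fun c q => wins_embed (g := (fun q => some (Sum.inl q) : A.Q → Option (A.Q ⊕ B.Q)))
      (fun a b h => Sum.inl_injective (Option.some_injective _ h)) (fun _ => rfl)
      (fun _ _ => rfl) c q
  have hB : ∀ c q, Wins (A.sum B).Ω ((A.sum B).system (fun c d => d :: c) 𝔅 fun c => {p | c ∈ V p})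
      c (some (Sum.inr q) : Option (A.Q ⊕ B.Q)) ↔ Wins B.Ω (B.system (fun c d => d :: c) 𝔅 fun c => {p | c ∈ V p}) c q :=
    fun c q => wins_embed (g := (fun q => some (Sum.inr q) : B.Q → Option (A.Q ⊕ B.Q)))
      (fun a b h => Sum.inr_injective (Option.some_injective _ h)) (fun _ => rfl)
      (fun _ _ => rfl) c q
  unfold AccTree Acc
  rw [wins_unfold (system_mono _ _ _ _), wins_unfold (A.system_mono _ _ _),
    wins_unfold (B.system_mono _ _ _)]
  simp only [← hA, ← hB]
  rfl

end Aut

/-! ### Projection automata -/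

namespace Aut

section Projection

variable {Q Dst D : Type}

/-- Transition of the subset construction paired with a deterministic automaton. -/
def subsetStep (step : Dst → Set (Q × Q) → Dst) (s : Set Q × Dst) (w : Set (Q × Q)) :
    Set Q × Dst :=
  ({q' | ∃ q ∈ s.1, (q, q') ∈ w}, step s.2 w)

/-- Run of the subset construction along a finite sequence. -/
def subsetRun (step : Dst → Set (Q × Q) → Dst) (s₀ : Set Q × Dst)
    (ρ : List D → Set Q × Dst → D → Set (Q × Q)) : List D → Set Q × Dst
  | [] => s₀
  | d :: c => subsetStep step (subsetRun step s₀ ρ c) (ρ c (subsetRun step s₀ ρ c) d)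

theorem detRun_eq_subsetRun (step : Dst → Set (Q × Q) → Dst) (s₀ : Set Q × Dst)
    (ρ : List D → Set Q × Dst → D → Set (Q × Q)) {x : ℕ → List D} {d : ℕ → D} (h0 : x 0 = [])
    (hx : ∀ i, x (i + 1) = d i :: x i) (i : ℕ) :
    detRun step s₀.2 (fun i => ρ (x i) (subsetRun step s₀ ρ (x i)) (d i)) i =
      (subsetRun step s₀ ρ (x i)).2 := by
  induction i with
  | zero => rw [h0]; rfl
  | succ i ih =>
    rw [hx]
    simp only [detRun, ih]
    rfl

/-- The set of letters obtained from `col` by deciding the letter `p` as `b`. -/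
def updCol (col : Set ℕ) (p : ℕ) (b : Prop) : Set ℕ := {r | if r = p then b else r ∈ col}

/-- Automaton for `∃ p`, built from a determinization of the traces. -/
def proj (A : Aut) [Finite Dst] (d₀ : Dst) (step : Dst → Set (A.Q × A.Q) → Dst) (pr : Dst → ℕ)
    (p : ℕ) : Aut where
  Q := Set A.Q × Dst
  fin := inferInstance
  Ω s := pr s.2
  init := ({A.init}, d₀)
  bd := A.bd
  δ D 𝔅 col s U := ∃ (b : Prop) (ρ : D → Set (A.Q × A.Q)),
    (∀ q ∈ s.1, A.δ D 𝔅 (updCol col p b) q fun q' => {x | (q, q') ∈ ρ x}) ∧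
      ∀ x, x ∈ U (subsetStep step s (ρ x))
  transfer e 𝔅 𝔅' h𝔅 col col' hcol s U U' hU h := by
    obtain ⟨b, ρ, h1, h2⟩ := h
    refine ⟨b, fun x => ρ (e.symm x), fun q hq => ?_, fun x => ?_⟩
    · refine A.transfer e 𝔅 𝔅' h𝔅 _ _ (fun r hr => ?_) q _ _ (fun k d hd => ?_) (h1 q hq)
      · simp only [updCol, Set.mem_ofPred_eq]
        split_ifs
        · rfl
        · exact hcol r hr
      · simpa using hd
    · simpa using hU _ _ (h2 (e.symm x))

theorem colors_updV (V : ℕ → Set (List D)) (p : ℕ) (Z : Set (List D)) (c : List D) :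
    {r | c ∈ updV V p Z r} = updCol {r | c ∈ V r} p (c ∈ Z) := by
  ext r
  simp only [updV, updCol, Set.mem_ofPred_eq]
  split_ifs <;> rfl

theorem proj_acc (A : Aut) [Finite Dst] (d₀ : Dst) (step : Dst → Set (A.Q × A.Q) → Dst)
    (pr : Dst → ℕ)
    (hdet : ∀ w : ℕ → Set (A.Q × A.Q),
      (∀ q : ℕ → A.Q, q 0 = A.init → (∀ i, (q i, q (i + 1)) ∈ w i) →
        ParityWin fun i => A.Ω (q i)) ↔ ParityWin fun i => pr (detRun step d₀ w i))
    (p : ℕ) (𝔅 : List D → Set (Set D)) (V : ℕ → Set (List D)) :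
    (A.proj d₀ step pr p).AccTree 𝔅 V ↔ ∃ Z, A.AccTree 𝔅 (updV V p Z) := by
  let s₀ : Set A.Q × Dst := ({A.init}, d₀)
  unfold AccTree Acc
  simp only [colors_updV]
  constructor
  · rintro ⟨R, f, h0, hf, hw⟩
    have hex : ∀ c s, ∃ (b : Prop) (ρ : D → Set (A.Q × A.Q)), c ∈ R s →
        (∀ q ∈ s.1, A.δ D (𝔅 c) (updCol {r | c ∈ V r} p b) q fun q' => {x | (q, q') ∈ ρ x}) ∧
        ∀ x, x :: c ∈ f c s (subsetStep step s (ρ x)) := by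
      intro c s
      by_cases hc : c ∈ R s
      · obtain ⟨b, ρ, h⟩ := (hf s c hc).1
        exact ⟨b, ρ, fun _ => h⟩
      · exact ⟨True, fun _ => ∅, fun h => (hc h).elim⟩
    choose b ρ hρ using hex
    let st := subsetRun step s₀ ρ
    have hR : ∀ c, c ∈ R (st c) := by
      intro c
      induction c with
      | nil => exact h0
      | cons d c ih => exact (hf _ c ih).2 _ ((hρ c _ ih).2 d)
    refine ⟨{c | b c (st c)}, fun q => {c | q ∈ (st c).1},
      fun c q q' => {x | ∃ d, x = d :: c ∧ (q, q') ∈ ρ c (st c) d}, rfl, ?_, ?_⟩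
    · intro q c hc
      refine ⟨?_, ?_⟩
      · refine A.transfer (Equiv.refl D) (𝔅 c) (𝔅 c) (fun _ => Iff.rfl) _ _ (fun _ _ => Iff.rfl)
          q _ _ ?_ ((hρ c _ (hR c)).1 q hc)
        exact fun k d hd => ⟨d, rfl, hd⟩
      · rintro k x ⟨d, rfl, hd⟩
        exact ⟨q, hc, hd⟩
    · intro x q hx0 hq0 hstep
      choose d hd hdq using hstep
      refine (hdet fun i => ρ (x i) (st (x i)) (d i)).2 ?_ q hq0 hdq
      have := hw x (fun i => st (x i)) hx0 (by simp only [hx0]; rfl) fun i => by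
        rw [hd i]
        exact (hρ (x i) _ (hR _)).2 (d i)
      have hrun := detRun_eq_subsetRun step s₀ ρ hx0 hd
      simp only [st, hrun, show d₀ = s₀.2 from rfl]
      exact this
  · rintro ⟨Z, R, f, h0, hf, hw⟩
    let ρ : List D → Set A.Q × Dst → D → Set (A.Q × A.Q) :=
      fun c _ d => {k | d :: c ∈ f c k.1 k.2}
    let st := subsetRun step s₀ ρ
    have hR : ∀ c, ∀ q ∈ (st c).1, c ∈ R q := by
      intro c
      induction c with
      | nil => rintro q rfl; exact h0
      | cons d c ih =>
        rintro q ⟨q', hq', h⟩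
        exact (hf q' c (ih q' hq')).2 q h
    refine ⟨fun s => {c | st c = s}, fun c _ k => {x | ∃ d, x = d :: c ∧ st x = k}, rfl, ?_, ?_⟩
    · rintro s c rfl
      refine ⟨⟨c ∈ Z, ρ c (st c), fun q hq => (hf q c (hR c q hq)).1, fun d => ⟨d, rfl, rfl⟩⟩, ?_⟩
      rintro k x ⟨d, rfl, h⟩
      exact h
    · intro x s hx0 hs0 hstep
      choose d hd hds using hstep
      have hst : ∀ i, s i = st (x i) := by
        intro i
        cases i with
        | zero => rw [hs0, hx0]; rfl
        | succ i => exact (hds i).symm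
      have := (hdet fun i => ρ (x i) (st (x i)) (d i)).1 fun q hq0 hq => by
        refine hw x q hx0 hq0 fun i => ?_
        rw [hd i]
        exact hq i
      have hrun := detRun_eq_subsetRun step s₀ ρ hx0 hd
      simp only [st, show d₀ = s₀.2 from rfl, hrun] at this
      simp only [hst]
      exact this

end Projection

end Aut

/-- Every second-order formula is equivalent to an automaton over trees. -/
theorem exists_aut (φ : MMSOForm) : ∃ A : Aut, ∀ (D : Type) (𝔅 : List D → Set (Set D))
    (V : ℕ → Set (List D)), φ.sat (treeNbhd 𝔅) V [] ↔ A.AccTree 𝔅 V := by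
  induction φ with
  | sr p => exact ⟨.single p, fun _ 𝔅 V => (Aut.single_acc p 𝔅 V).symm⟩
  | subset p q => exact ⟨.incl p q, fun _ 𝔅 V => (Aut.incl_acc p q 𝔅 V).symm⟩
  | box p q => exact ⟨.boxAut p q, fun _ 𝔅 V => (Aut.boxAut_acc p q 𝔅 V).symm⟩
  | neg φ ih =>
    obtain ⟨A, hA⟩ := ih
    exact ⟨A.compl, fun D 𝔅 V => (not_congr (hA D 𝔅 V)).trans (A.compl_acc 𝔅 V).symm⟩
  | or φ ψ ih₁ ih₂ =>
    obtain ⟨A, hA⟩ := ih₁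
    obtain ⟨B, hB⟩ := ih₂
    exact ⟨A.sum B, fun D 𝔅 V => (or_congr (hA D 𝔅 V) (hB D 𝔅 V)).trans (A.sum_acc B 𝔅 V).symm⟩
  | ex p φ ih =>
    obtain ⟨A, hA⟩ := ih
    obtain ⟨Dst, _, d₀, step, pr, hdet⟩ := exists_determinization A.Ω A.init
    exact ⟨A.proj d₀ step pr p, fun D 𝔅 V => (exists_congr fun Z => hA D 𝔅 _).trans
      (A.proj_acc d₀ step pr hdet p 𝔅 V).symm⟩

/-! ### Invariance of the modal μ-calculus -/

theorem MuG.sem_of_bisim {S₁ S₂ : Type} {σ₁ : S₁ → MObj S₁} {σ₂ : S₂ → MObj S₂}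
    {R : S₁ → S₂ → Prop}
    (forth : ∀ s₁ s₂, R s₁ s₂ → ∀ Z₁ ∈ (σ₁ s₁).1, ∃ Z₂ ∈ (σ₂ s₂).1, ∀ t₂ ∈ Z₂, ∃ t₁ ∈ Z₁, R t₁ t₂)
    (back : ∀ s₁ s₂, R s₁ s₂ → ∀ Z₂ ∈ (σ₂ s₂).1, ∃ Z₁ ∈ (σ₁ s₁).1, ∀ t₁ ∈ Z₁, ∃ t₂ ∈ Z₂, R t₁ t₂)
    (full₁ : ∀ u : S₁, ∃ v : S₂, R u v) (full₂ : ∀ v : S₂, ∃ u : S₁, R u v) (ψ : MuG)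
    (hψ : ψ.WF) : ∀ (V₁ : ℕ → Set S₁) (V₂ : ℕ → Set S₂),
    (∀ p s₁ s₂, R s₁ s₂ → s₁ ∈ V₁ p → s₂ ∈ V₂ p) →
    (∀ p, ¬ ψ.PosIn p → ∀ s₁ s₂, R s₁ s₂ → s₂ ∈ V₂ p → s₁ ∈ V₁ p) →
    ∀ s₁ s₂, R s₁ s₂ → s₁ ∈ ψ.sem σ₁ V₁ → s₂ ∈ ψ.sem σ₂ V₂ := by
  induction ψ with
  | var p => exact fun V₁ V₂ h _ => h p
  | nvar p => exact fun V₁ V₂ _ h s₁ s₂ hR hs hs' => hs (h p (fun h => h rfl) s₁ s₂ hR hs')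
  | bot => exact fun _ _ _ _ _ _ _ h => h
  | top => exact fun _ _ _ _ _ _ _ h => h
  | box φ ih =>
    intro V₁ V₂ h h' s₁ s₂ hR hs
    obtain ⟨Z, hZ, hZ'⟩ := forth s₁ s₂ hR _ hs
    refine (σ₂ s₂).2 _ _ hZ fun t₂ ht₂ => ?_
    obtain ⟨t₁, ht₁, hR'⟩ := hZ' t₂ ht₂
    exact ih hψ V₁ V₂ h h' t₁ t₂ hR' ht₁
  | dia φ ih =>
    intro V₁ V₂ h h' s₁ s₂ hR hs hs'
    obtain ⟨Z, hZ, hZ'⟩ := back s₁ s₂ hR _ hs'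
    refine hs ((σ₁ s₁).2 _ _ hZ fun t₁ ht₁ hn => ?_)
    obtain ⟨t₂, ht₂, hR'⟩ := hZ' t₁ ht₁
    exact ht₂ (ih hψ V₁ V₂ h h' t₁ t₂ hR' hn)
  | all φ ih =>
    intro V₁ V₂ h h' s₁ s₂ hR hs v
    obtain ⟨u, hu⟩ := full₂ v
    exact ih hψ V₁ V₂ h h' u v hu (hs u)
  | exm φ ih =>
    rintro V₁ V₂ h h' s₁ s₂ hR ⟨u, hu⟩
    obtain ⟨v, hv⟩ := full₁ u
    exact ⟨v, ih hψ V₁ V₂ h h' u v hv hu⟩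
  | or φ ψ ih₁ ih₂ =>
    intro V₁ V₂ h h' s₁ s₂ hR hs
    exact hs.imp
      (ih₁ hψ.1 V₁ V₂ h (fun p hp => h' p fun hp' => hp hp'.1) s₁ s₂ hR)
      (ih₂ hψ.2 V₁ V₂ h (fun p hp => h' p fun hp' => hp hp'.2) s₁ s₂ hR)
  | and φ ψ ih₁ ih₂ =>
    intro V₁ V₂ h h' s₁ s₂ hR hs
    exact hs.imp
      (ih₁ hψ.1 V₁ V₂ h (fun p hp => h' p fun hp' => hp hp'.1) s₁ s₂ hR)
      (ih₂ hψ.2 V₁ V₂ h (fun p hp => h' p fun hp' => hp hp'.2) s₁ s₂ hR)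
  | mu p φ ih =>
    intro V₁ V₂ h h' s₁ s₂ hR hs Z₂ hZ₂
    refine hs {s | ∀ s', R s s' → s' ∈ Z₂} (fun t₁ ht₁ t₂ hR' => hZ₂ ?_) s₂ hR
    refine ih hψ.2 _ _ (fun r u₁ u₂ hu hr => ?_) (fun r hr u₁ u₂ hu hr' => ?_) t₁ t₂ hR' ht₁
    · simp only [updV] at hr ⊢
      split_ifs at hr ⊢
      · exact hr u₂ hu
      · exact h r u₁ u₂ hu hr
    · simp only [updV] at hr' ⊢
      split_ifs at hr' ⊢ with hrp
      · exact absurd (hrp ▸ hψ.1) hr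
      · exact h' r (fun hor => hor.elim (fun he => hrp he.symm) hr) u₁ u₂ hu hr'
  | nu p φ ih =>
    rintro V₁ V₂ h h' s₁ s₂ hR ⟨Z₁, hZ₁, hs⟩
    refine ⟨{s' | ∃ s ∈ Z₁, R s s'}, ?_, s₁, hs, hR⟩
    rintro t₂ ⟨t₁, ht₁, hR'⟩
    refine ih hψ.2 _ _ (fun r u₁ u₂ hu hr => ?_) (fun r hr u₁ u₂ hu hr' => ?_) t₁ t₂ hR' (hZ₁ ht₁)
    · simp only [updV] at hr ⊢
      split_ifs at hr ⊢
      · exact ⟨u₁, hr, hu⟩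
      · exact h r u₁ u₂ hu hr
    · simp only [updV] at hr' ⊢
      split_ifs at hr' ⊢ with hrp
      · exact absurd (hrp ▸ hψ.1) hr
      · exact h' r (fun hor => hor.elim (fun he => hrp he.symm) hr) u₁ u₂ hu hr'

theorem MuG.sem_iff_of_globalNBisim {S₁ S₂ : Type} {σ₁ : S₁ → MObj S₁} {V₁ : ℕ → Set S₁}
    {σ₂ : S₂ → MObj S₂} {V₂ : ℕ → Set S₂} {R : S₁ → S₂ → Prop}
    (hR : GlobalNBisim σ₁ V₁ σ₂ V₂ R) {ψ : MuG} (hψ : ψ.WF) {s₁ : S₁} {s₂ : S₂} (h : R s₁ s₂) :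
    s₁ ∈ ψ.sem σ₁ V₁ ↔ s₂ ∈ ψ.sem σ₂ V₂ := by
  obtain ⟨hB, h₁, h₂⟩ := hR
  constructor
  · exact MuG.sem_of_bisim (fun s₁ s₂ h => (hB s₁ s₂ h).2.1) (fun s₁ s₂ h => (hB s₁ s₂ h).2.2)
      h₁ h₂ ψ hψ V₁ V₂ (fun p s₁ s₂ h => ((hB s₁ s₂ h).1 p).1)
      (fun p _ s₁ s₂ h => ((hB s₁ s₂ h).1 p).2) s₁ s₂ h
  · exact MuG.sem_of_bisim (R := fun s₂ s₁ => R s₁ s₂) (fun s₂ s₁ h => (hB s₁ s₂ h).2.2)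
      (fun s₂ s₁ h => (hB s₁ s₂ h).2.1) h₂ h₁ ψ hψ V₂ V₁ (fun p s₂ s₁ h => ((hB s₁ s₂ h).1 p).2)
      (fun p _ s₂ s₁ h => ((hB s₁ s₂ h).1 p).1) s₂ s₁ h

/-! ### Expansions of neighborhood structures by blocks -/

section Matching

theorem exists_equiv_prod {T K : Type} [Nonempty T] [Infinite K]
    (h : Cardinal.mk T ≤ Cardinal.mk K) : Nonempty (K ≃ T × K) := by
  rw [← Cardinal.eq, Cardinal.mk_prod, Cardinal.lift_id, Cardinal.lift_id,
    Cardinal.mul_eq_right (Cardinal.aleph0_le_mk K) h (Cardinal.mk_ne_zero T)]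

/-- A relation that is full on both sides is contained in the graph of a bijection, up to
multiplying with a large set. -/
theorem exists_matching {A B K : Type} [Infinite K] (hA : Cardinal.mk A ≤ Cardinal.mk K)
    (hB : Cardinal.mk B ≤ Cardinal.mk K) (r : A → B → Prop) (h₁ : ∀ a, ∃ b, r a b)
    (h₂ : ∀ b, ∃ a, r a b) : ∃ e : A × K ≃ B × K, ∀ x, r x.1 (e x).1 := by
  have hg : ∀ a, Nonempty (K ≃ {b // r a b} × K) := fun a =>
    have : Nonempty {b // r a b} := let ⟨b, hb⟩ := h₁ a; ⟨⟨b, hb⟩⟩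
    exists_equiv_prod ((Cardinal.mk_subtype_le _).trans hB)
  have hh : ∀ b, Nonempty (K ≃ {a // r a b} × K) := fun b =>
    have : Nonempty {a // r a b} := let ⟨a, ha⟩ := h₂ b; ⟨⟨a, ha⟩⟩
    exists_equiv_prod ((Cardinal.mk_subtype_le _).trans hA)
  let g := fun a => (hg a).some
  let h := fun b => (hh b).some
  let m : (Σ a, {b // r a b} × K) ≃ Σ b, {a // r a b} × K :=
    ⟨fun x => ⟨x.2.1.1, ⟨x.1, x.2.1.2⟩, x.2.2⟩, fun x => ⟨x.2.1.1, ⟨x.1, x.2.1.2⟩, x.2.2⟩,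
      fun _ => rfl, fun _ => rfl⟩
  exact ⟨((Equiv.sigmaEquivProd A K).symm.trans (Equiv.sigmaCongrRight g)).trans
    (m.trans ((Equiv.sigmaCongrRight h).symm.trans (Equiv.sigmaEquivProd B K))),
    fun x => (g x.1 x.2).1.2⟩

end Matching

/-- Elements of the expansion of `S`: a set and an index naming a block, a state, and an index. -/
abbrev Expn (S K : Type) : Type := Set S × K × S × K

namespace Expn

variable {S S' K : Type}

/-- The state that an element is a copy of. -/
def lab (d : Expn S K) : S := d.2.2.1

/-- The block with name `(Z, i)`. -/
def block (Z : Set S) (i : K) : Set (Expn S K) := {d | d.1 = Z ∧ d.2.1 = i ∧ d.lab ∈ Z}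

/-- The blocks representing a collection of sets. -/
def blocks (K : Type) (N : Set (Set S)) : Set (Set (Expn S K)) :=
  {B | ∃ Z ∈ N, ∃ i, B = block Z i}

/-- The disjoint union of the nonempty blocks and the free elements. -/
abbrev Canon (K : Type) (N : Set (Set S)) : Type :=
  (Σ b : {Z : Set S // Z ∈ N ∧ Z.Nonempty} × K, b.1.1 × K) ⊕ (S × K)

/-- The states of elements of `Canon`. -/
def Canon.lab {N : Set (Set S)} : Canon K N → S
  | .inl x => x.2.1
  | .inr x => x.1

theorem exists_equiv_canon [Infinite K] (hS : Cardinal.mk (Set S) ≤ Cardinal.mk K)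
    (N : Set (Set S)) : ∃ e : Expn S K ≃ Canon K N, (∀ d, (e d).lab = d.lab) ∧
      ∀ (b : {Z : Set S // Z ∈ N ∧ Z.Nonempty} × K) d,
        (∃ y, e d = .inl ⟨b, y⟩) ↔ d ∈ block b.1.1 b.2 := by
  let Fr := {d : Expn S K // ¬ (d.1 ∈ N ∧ d.lab ∈ d.1)}
  have hfib : ∀ t : S, Nonempty ({d : Fr // d.1.lab = t} ≃ K) := by
    intro t
    rw [← Cardinal.eq]
    apply le_antisymm
    · refine (Cardinal.mk_le_of_injective (f := fun d : {d : Fr // d.1.lab = t} =>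
        (d.1.1.1, d.1.1.2.1, d.1.1.2.2.2)) ?_).trans (?_ : Cardinal.mk (Set S × K × K) ≤ _)
      · rintro ⟨⟨⟨Z, i, t', j⟩, h⟩, rfl⟩ ⟨⟨⟨Z', i', t'', j'⟩, h'⟩, ht⟩ he
        simp only [Prod.mk.injEq] at he
        obtain ⟨rfl, rfl, rfl⟩ := he
        change t'' = t' at ht
        subst ht
        rfl
      · simp only [Cardinal.mk_prod, Cardinal.lift_id]
        have hK := Cardinal.aleph0_le_mk K
        rw [Cardinal.mul_eq_self hK]
        exact Cardinal.mul_le_of_le hK hS le_rfl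
    · exact Cardinal.mk_le_of_injective (f := fun j : K =>
        (⟨⟨(∅, j, t, j), fun h => h.2⟩, rfl⟩ : {d : Fr // d.1.lab = t})) fun j j' h =>
          congrArg (fun d : {d : Fr // d.1.lab = t} => d.1.1.2.1) h
  let ef : Fr ≃ S × K := ((Equiv.sigmaFiberEquiv fun d : Fr => d.1.lab).symm.trans
    (Equiv.sigmaCongrRight fun t => (hfib t).some)).trans (Equiv.sigmaEquivProd S K)
  let eb : {d : Expn S K // d.1 ∈ N ∧ d.lab ∈ d.1} ≃
      Σ b : {Z : Set S // Z ∈ N ∧ Z.Nonempty} × K, b.1.1 × K :=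
    ⟨fun d => ⟨(⟨d.1.1, d.2.1, ⟨_, d.2.2⟩⟩, d.1.2.1), (⟨d.1.lab, d.2.2⟩, d.1.2.2.2)⟩,
      fun x => ⟨(x.1.1.1, x.1.2, x.2.1.1, x.2.2), x.1.1.2.1, x.2.1.2⟩,
      fun d => rfl, fun x => rfl⟩
  refine ⟨(Equiv.sumCompl fun d : Expn S K => d.1 ∈ N ∧ d.lab ∈ d.1).symm.trans
    (Equiv.sumCongr eb ef), fun d => ?_, fun b d => ?_⟩
  · by_cases hd : d.1 ∈ N ∧ d.lab ∈ d.1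
    · rw [Equiv.trans_apply, Equiv.sumCompl_symm_apply_of_pos (p := fun d : Expn S K => d.1 ∈ N ∧ d.lab ∈ d.1) hd]
      rfl
    · rw [Equiv.trans_apply, Equiv.sumCompl_symm_apply_of_neg (p := fun d : Expn S K => d.1 ∈ N ∧ d.lab ∈ d.1) hd]
      rfl
  · by_cases hd : d.1 ∈ N ∧ d.lab ∈ d.1
    · rw [Equiv.trans_apply, Equiv.sumCompl_symm_apply_of_pos (p := fun d : Expn S K => d.1 ∈ N ∧ d.lab ∈ d.1) hd]
      constructor
      · rintro ⟨y, hy⟩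
        have : (eb ⟨d, hd⟩).1 = b := congrArg Sigma.fst (Sum.inl.inj hy)
        rw [← this]
        exact ⟨rfl, rfl, hd.2⟩
      · rintro ⟨h1, h2, h3⟩
        obtain ⟨⟨Z, hZ⟩, i⟩ := b
        obtain ⟨Z', i', t, j⟩ := d
        change Z' = Z at h1
        change i' = i at h2
        subst h1 h2
        exact ⟨_, rfl⟩
    · rw [Equiv.trans_apply, Equiv.sumCompl_symm_apply_of_neg (p := fun d : Expn S K => d.1 ∈ N ∧ d.lab ∈ d.1) hd]
      refine iff_of_false (fun ⟨y, hy⟩ => Sum.inr_ne_inl hy) fun h => hd ?_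
      rw [h.1]
      exact ⟨b.1.2.1, h.2.2⟩

theorem exists_canon_equiv [Infinite K] (hS : Cardinal.mk (Set S) ≤ Cardinal.mk K)
    (hS' : Cardinal.mk (Set S') ≤ Cardinal.mk K) (N : MObj S) (N' : MObj S') (r : S → S' → Prop)
    (full₁ : ∀ s, ∃ s', r s s') (full₂ : ∀ s', ∃ s, r s s')
    (forth : ∀ Z ∈ N.1, ∃ Z' ∈ N'.1, ∀ t' ∈ Z', ∃ t ∈ Z, r t t')
    (back : ∀ Z' ∈ N'.1, ∃ Z ∈ N.1, ∀ t ∈ Z, ∃ t' ∈ Z', r t t') :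
    ∃ (e : Canon K N.1 ≃ Canon K N'.1) (e₁ : {Z : Set S // Z ∈ N.1 ∧ Z.Nonempty} × K ≃
        {Z : Set S' // Z ∈ N'.1 ∧ Z.Nonempty} × K), (∀ d, r d.lab (e d).lab) ∧
      ∀ b d, (∃ y, e d = .inl ⟨e₁ b, y⟩) ↔ ∃ y, d = .inl ⟨b, y⟩ := by
  have hle : Cardinal.mk S ≤ Cardinal.mk K :=
    (Cardinal.mk_le_of_injective (f := fun s : S => ({s} : Set S))
      fun a b h => Set.singleton_injective h).trans hS
  have hle' : Cardinal.mk S' ≤ Cardinal.mk K :=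
    (Cardinal.mk_le_of_injective (f := fun s : S' => ({s} : Set S'))
      fun a b h => Set.singleton_injective h).trans hS'
  obtain ⟨ef, hef⟩ := exists_matching hle hle' r full₁ full₂
  obtain ⟨e₁, he₁⟩ := exists_matching (A := {Z : Set S // Z ∈ N.1 ∧ Z.Nonempty})
    (B := {Z : Set S' // Z ∈ N'.1 ∧ Z.Nonempty}) (K := K)
    ((Cardinal.mk_subtype_le _).trans hS) ((Cardinal.mk_subtype_le _).trans hS')
    (fun Z Z' => (∀ t ∈ Z.1, ∃ t' ∈ Z'.1, r t t') ∧ ∀ t' ∈ Z'.1, ∃ t ∈ Z.1, r t t')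
    (by
      rintro ⟨Z, hZ, s, hs⟩
      obtain ⟨Z', hZ', h⟩ := forth Z hZ
      obtain ⟨s', hs'⟩ := full₁ s
      refine ⟨⟨Z' ∪ {t' | ∃ t ∈ Z, r t t'}, N'.2 _ _ hZ' Set.subset_union_left,
        s', Or.inr ⟨s, hs, hs'⟩⟩, fun t ht => ?_, fun t' ht' => ht'.elim (h t') id⟩
      obtain ⟨t', ht'⟩ := full₁ t
      exact ⟨t', Or.inr ⟨t, ht, ht'⟩, ht'⟩)
    (by
      rintro ⟨Z', hZ', s', hs'⟩
      obtain ⟨Z, hZ, h⟩ := back Z' hZ'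
      obtain ⟨s, hs⟩ := full₂ s'
      refine ⟨⟨Z ∪ {t | ∃ t' ∈ Z', r t t'}, N.2 _ _ hZ Set.subset_union_left,
        s, Or.inr ⟨s', hs', hs⟩⟩, fun t ht => ht.elim (h t) id, fun t' ht' => ?_⟩
      obtain ⟨t, ht⟩ := full₂ t'
      exact ⟨t, Or.inr ⟨t', ht', ht⟩, ht⟩)
  have hb : ∀ b, ∃ e : b.1.1 × K ≃ (e₁ b).1.1 × K, ∀ x, r x.1.1 (e x).1.1 := fun b =>
    exists_matching ((Cardinal.mk_set_le _).trans hle) ((Cardinal.mk_set_le _).trans hle')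
      (fun t t' => r t.1 t'.1)
      (fun t => let ⟨t', ht', h⟩ := (he₁ b).1 t.1 t.2; ⟨⟨t', ht'⟩, h⟩)
      (fun t' => let ⟨t, ht, h⟩ := (he₁ b).2 t'.1 t'.2; ⟨⟨t, ht⟩, h⟩)
  choose eb heb using hb
  refine ⟨Equiv.sumCongr (Equiv.sigmaCongr e₁ eb) ef, e₁, ?_, ?_⟩
  · rintro (⟨b, x⟩ | x)
    · exact heb b x
    · exact hef x
  · rintro b (⟨b', x⟩ | x)
    · constructor
      · rintro ⟨y, hy⟩
        have : e₁ b' = e₁ b := congrArg Sigma.fst (Sum.inl.inj hy)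
        obtain rfl := e₁.injective this
        exact ⟨x, rfl⟩
      · rintro ⟨y, hy⟩
        obtain rfl : b' = b := congrArg Sigma.fst (Sum.inl.inj hy)
        exact ⟨eb b' x, rfl⟩
    · exact iff_of_false (fun ⟨y, hy⟩ => Sum.inr_ne_inl hy) fun ⟨y, hy⟩ => Sum.inr_ne_inl hy

/-- Expansions of related neighborhood structures are isomorphic. -/
theorem exists_equiv [Infinite K] (hS : Cardinal.mk (Set S) ≤ Cardinal.mk K)
    (hS' : Cardinal.mk (Set S') ≤ Cardinal.mk K) (N : MObj S) (N' : MObj S') (r : S → S' → Prop)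
    (full₁ : ∀ s, ∃ s', r s s') (full₂ : ∀ s', ∃ s, r s s')
    (forth : ∀ Z ∈ N.1, ∃ Z' ∈ N'.1, ∀ t' ∈ Z', ∃ t ∈ Z, r t t')
    (back : ∀ Z' ∈ N'.1, ∃ Z ∈ N.1, ∀ t ∈ Z, ∃ t' ∈ Z', r t t') :
    ∃ e : Expn S K ≃ Expn S' K, (∀ d, r d.lab (e d).lab) ∧
      ∀ B', B' ∈ blocks K N'.1 ↔ e ⁻¹' B' ∈ blocks K N.1 := by
  obtain ⟨c, hc, hcb⟩ := exists_equiv_canon hS N.1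
  obtain ⟨c', hc', hcb'⟩ := exists_equiv_canon hS' N'.1
  obtain ⟨m, e₁, hm, hmb⟩ := exists_canon_equiv hS hS' N N' r full₁ full₂ forth back
  let e := (c.trans m).trans c'.symm
  have hblk : ∀ b, e ⁻¹' block (e₁ b).1.1 (e₁ b).2 = block b.1.1 b.2 := by
    intro b
    ext d
    rw [Set.mem_preimage, ← hcb', ← hcb, ← hmb]
    simp [e]
  have hempty : ∅ ∈ N.1 ↔ ∅ ∈ N'.1 := by
    constructor
    · intro h
      obtain ⟨Z', hZ', h'⟩ := forth _ h
      refine N'.2 _ _ hZ' fun t' ht' => ?_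
      obtain ⟨t, ht, -⟩ := h' t' ht'
      exact ht
    · intro h
      obtain ⟨Z, hZ, h'⟩ := back _ h
      refine N.2 _ _ hZ fun t ht => ?_
      obtain ⟨t', ht', -⟩ := h' t ht
      exact ht'
  have hbe : ∀ {T : Type} (i : K), block (∅ : Set T) i = ∅ := fun i =>
    Set.eq_empty_of_forall_notMem fun d h => h.2.2
  refine ⟨e, fun d => ?_, fun B' => ⟨?_, ?_⟩⟩
  · have := hm (c d)
    rw [hc, ← c'.apply_symm_apply (m (c d)), hc'] at this
    exact this
  · rintro ⟨Z', hZ', i, rfl⟩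
    rcases Z'.eq_empty_or_nonempty with rfl | hne
    · exact ⟨∅, hempty.2 hZ', i, by rw [hbe, hbe, Set.preimage_empty]⟩
    · obtain ⟨b, hb⟩ := e₁.surjective (⟨Z', hZ', hne⟩, i)
      have := hblk b
      rw [hb] at this
      exact ⟨b.1.1, b.1.2.1, b.2, this⟩
  · rintro ⟨Z, hZ, i, hB⟩
    rcases Z.eq_empty_or_nonempty with rfl | hne
    · refine ⟨∅, hempty.1 hZ, i, ?_⟩
      rw [hbe] at hB ⊢
      exact e.surjective.preimage_injective hB
    · refine ⟨_, (e₁ (⟨Z, hZ, hne⟩, i)).1.2.1, (e₁ (⟨Z, hZ, hne⟩, i)).2, ?_⟩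
      exact e.surjective.preimage_injective (hB.trans (hblk (⟨Z, hZ, hne⟩, i)).symm)

end Expn

/-! ### One-step descriptions -/

namespace Aut

theorem transfer_of_bisim (A : Aut) {S S' K : Type} [Infinite K]
    (hS : Cardinal.mk (Set S) ≤ Cardinal.mk K) (hS' : Cardinal.mk (Set S') ≤ Cardinal.mk K)
    (N : MObj S) (N' : MObj S') (r : S → S' → Prop)
    (full₁ : ∀ s, ∃ s', r s s') (full₂ : ∀ s', ∃ s, r s s')
    (forth : ∀ Z ∈ N.1, ∃ Z' ∈ N'.1, ∀ t' ∈ Z', ∃ t ∈ Z, r t t')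
    (back : ∀ Z' ∈ N'.1, ∃ Z ∈ N.1, ∀ t ∈ Z, ∃ t' ∈ Z', r t t')
    {col col' : Set ℕ} (hcol : ∀ p < A.bd, p ∈ col ↔ p ∈ col') (q : A.Q) {U : A.Q → Set S}
    {U' : A.Q → Set S'} (hU : ∀ k t t', r t t' → t ∈ U k → t' ∈ U' k)
    (h : A.δ (Expn S K) (Expn.blocks K N.1) col q fun k => {d | d.lab ∈ U k}) :
    A.δ (Expn S' K) (Expn.blocks K N'.1) col' q fun k => {d | d.lab ∈ U' k} := by
  obtain ⟨e, he, hb⟩ := Expn.exists_equiv hS hS' N N' r full₁ full₂ forth back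
  exact A.transfer e _ _ hb col col' hcol q _ _ (fun k d hd => hU k _ _ (he d) hd) h

/-- Finite descriptions of positions: a state, the letters that are true, a set of types and a
collection of sets of types. -/
abbrev Descr (A : Aut) : Type :=
  A.Q × Set (Fin A.bd) × Σ G : Set (Set A.Q), Set (Set G)

/-- The set of letters given by a set of indices. -/
def letters {n : ℕ} (L : Set (Fin n)) : Set ℕ := {p | ∃ h : p < n, ⟨p, h⟩ ∈ L}

/-- The descriptions allowed by the transition function. -/
def table (A : Aut) (K : Type) : Set A.Descr :=
  {x | (∀ Z Z', Z ∈ x.2.2.2 → Z ⊆ Z' → Z' ∈ x.2.2.2) ∧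
    A.δ (Expn x.2.2.1 K) (Expn.blocks K x.2.2.2) (letters x.2.1) x.1 fun k => {d | k ∈ d.lab.1}}

/-- The pair `(G, T)` of a set of types and a collection of sets of types describes the pair
`(N, U)`. -/
def Describes {Q S : Type} (G : Set (Set Q)) (T : Set (Set G)) (N : Set (Set S))
    (U : Q → Set S) : Prop :=
  (∀ t, ∃ x : G, ∀ k ∈ x.1, t ∈ U k) ∧ (∀ x : G, ∃ t, ∀ k ∈ x.1, t ∈ U k) ∧
    (∀ τ ∈ T, {t | ∃ x ∈ τ, ∀ k ∈ x.1, t ∈ U k} ∈ N) ∧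
    ∀ τ ∉ T, {t | ∃ x ∉ τ, ∀ k ∈ x.1, t ∈ U k}ᶜ ∉ N

theorem mk_set_le_of_finite {T K : Type} [Finite T] [Infinite K] :
    Cardinal.mk (Set T) ≤ Cardinal.mk K :=
  (Cardinal.lt_aleph0_of_finite (Set T)).le.trans (Cardinal.aleph0_le_mk K)

theorem delta_iff_exists_describes (A : Aut) {S K : Type} [Infinite K]
    (hS : Cardinal.mk (Set S) ≤ Cardinal.mk K) (N : MObj S) (col : Set ℕ) (q : A.Q)
    (U : A.Q → Set S) :
    (A.δ (Expn S K) (Expn.blocks K N.1) col q fun k => {d | d.lab ∈ U k}) ↔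
      ∃ x ∈ A.table K, x.1 = q ∧ (∀ p, p ∈ x.2.1 ↔ p.1 ∈ col) ∧
        Describes x.2.2.1 x.2.2.2 N.1 U := by
  constructor
  · intro h
    let X : S → Set A.Q := fun t => {k | t ∈ U k}
    let X' : S → Set.range X := fun t => ⟨X t, t, rfl⟩
    let T : MObj (Set.range X) := ⟨{τ | X' ⁻¹' τ ∈ N.1}, fun Z Z' hZ hsub =>
      N.2 _ _ hZ (Set.preimage_mono hsub)⟩
    refine ⟨(q, {p | p.1 ∈ col}, ⟨Set.range X, T.1⟩), ⟨T.2, ?_⟩, rfl, fun _ => Iff.rfl, ?_⟩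
    · refine A.transfer_of_bisim hS mk_set_le_of_finite N T (fun t x => x = X' t)
        (fun t => ⟨_, rfl⟩) ?_ (fun Z hZ => ?_) (fun τ hτ => ?_) (fun p hp => ?_) q
        (U' := fun k => {x | k ∈ x.1}) ?_ h
      · rintro ⟨x, t, rfl⟩
        exact ⟨t, rfl⟩
      · exact ⟨X' '' Z, N.2 _ _ hZ (Set.subset_preimage_image _ _), fun x ⟨t, ht, hx⟩ =>
          ⟨t, ht, hx.symm⟩⟩
      · exact ⟨X' ⁻¹' τ, hτ, fun t ht => ⟨X' t, ht, rfl⟩⟩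
      · exact ⟨fun h => ⟨hp, h⟩, fun ⟨_, h⟩ => h⟩
      · rintro k t x rfl ht
        exact ht
    · refine ⟨fun t => ⟨X' t, fun k hk => hk⟩, ?_, fun τ hτ => ?_, fun τ hτ hn => hτ ?_⟩
      · rintro ⟨x, t, rfl⟩
        exact ⟨t, fun k hk => hk⟩
      · exact N.2 _ _ hτ fun t ht => ⟨X' t, ht, fun k hk => hk⟩
      · refine N.2 _ _ hn fun t ht => ?_
        by_contra hc
        exact ht ⟨X' t, hc, fun k hk => hk⟩
  · rintro ⟨⟨q', L, G, T⟩, ⟨hT, h⟩, rfl, hL, h1, h2, h3, h4⟩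
    refine A.transfer_of_bisim mk_set_le_of_finite hS ⟨T, hT⟩ N
      (fun x t => ∀ k ∈ x.1, t ∈ U k) h2 h1 (fun τ hτ => ⟨_, h3 τ hτ, fun t ht => ht⟩)
      (fun Z hZ => ?_) (fun p hp => ?_) q' (U := fun k => {x | k ∈ x.1})
      (fun k x t hx hk => hx k hk) h
    · refine ⟨{x | ∃ t ∈ Z, ∀ k ∈ x.1, t ∈ U k}, ?_, fun x hx => hx⟩
      by_contra hτ
      exact h4 _ hτ (N.2 _ _ hZ fun t ht ⟨x, hx, hxt⟩ => hx ⟨t, ht, hxt⟩)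
    · exact ⟨fun ⟨_, h⟩ => (hL _).1 h, fun h => ⟨hp, (hL ⟨p, hp⟩).2 h⟩⟩

/-- Some table is realized by arbitrarily large index sets. -/
theorem exists_cofinal_table (A : Aut) : ∃ T : Set A.Descr, ∀ S : Type, ∃ K : Type,
    Infinite K ∧ Cardinal.mk (Set S) ≤ Cardinal.mk K ∧ A.table K = T := by
  by_contra hc
  push Not at hc
  choose S hS using hc
  have : Infinite (Set (ℕ ⊕ Σ T, S T)) :=
    Infinite.of_injective (fun n : ℕ => {Sum.inl n}) fun a b h =>
      Sum.inl_injective (Set.singleton_injective h)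
  refine hS _ (Set (ℕ ⊕ Σ T, S T)) this ?_ rfl
  exact Cardinal.mk_le_of_injective (f := Set.image fun s => Sum.inr ⟨_, s⟩)
    (Set.image_injective.2 fun a b h => by simpa using h)

end Aut

/-! ### Unravellings -/

section Unravelling

variable {S K : Type}

/-- The last state of a sequence. -/
def lastState (u : S) : List (Expn S K) → S
  | [] => u
  | d :: _ => d.lab

theorem globalNBisim_lastState [Nonempty K] (σ : S → MObj S) (V : ℕ → Set S) (u : S) :
    GlobalNBisim σ V (treeNbhd fun c : List (Expn S K) => Expn.blocks K (σ (lastState u c)).1)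
      (fun p => lastState u ⁻¹' V p) fun s c => lastState u c = s := by
  obtain ⟨i⟩ := ‹Nonempty K›
  refine ⟨?_, fun s => ⟨[(∅, i, s, i)], rfl⟩, fun c => ⟨_, rfl⟩⟩
  rintro s c rfl
  refine ⟨fun p => Iff.rfl, fun Z hZ => ?_, ?_⟩
  · refine ⟨{c' | ∃ d ∈ Expn.block Z i, c' = d :: c}, ⟨_, ⟨Z, hZ, i, rfl⟩, fun d hd =>
      ⟨d, hd, rfl⟩⟩, ?_⟩
    rintro t ⟨d, hd, rfl⟩
    exact ⟨d.lab, hd.2.2, rfl⟩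
  · rintro Z' ⟨B, ⟨Z, hZ, j, rfl⟩, hB⟩
    exact ⟨Z, hZ, fun t ht => ⟨_, hB (Z, j, t, i) ⟨rfl, rfl, ht⟩, rfl⟩⟩

/-- An invariant formula is evaluated by solving the system of an automaton on the model. -/
theorem sat_iff_mem_sol [Nonempty K] {φ : MMSOForm} (hφ : GlobalBisimInv φ) {A : Aut}
    (hA : ∀ (D : Type) (𝔅 : List D → Set (Set D)) (V : ℕ → Set (List D)),
      φ.sat (treeNbhd 𝔅) V [] ↔ A.AccTree 𝔅 V)
    {m : ℕ} {e : A.Q ≃ Fin m} (he : Monotone (A.Ω ∘ e.symm)) (y : ℕ → Set S)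
    (σ : S → MObj S) (V : ℕ → Set S) (u : S) :
    φ.sat σ V u ↔ u ∈ sol (enumPriority e A.Ω) (enumSystem e (A.system (fun _ d => Expn.lab d)
      (fun s => Expn.blocks K (σ s).1) fun s => {p | s ∈ V p})) m y (e A.init) := by
  rw [hφ _ _ _ u _ _ _ [] _ (globalNBisim_lastState (K := K) σ V u) rfl, hA]
  unfold Aut.AccTree Aut.Acc
  rw [wins_iff_mem_sol e (enumSystem_mono e (A.system_mono _ _ _)) (enumPriority_mono he)
    (enumPriority_apply e A.Ω) (enumSystem_apply e _) (fun k => lastState u ⁻¹' y k),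
    sol_preimage (lastState u) (enumSystem_mono e (A.system_mono _ _ _)) (β := enumSystem e
      (A.system (fun _ d => Expn.lab d) (fun s => Expn.blocks K (σ s).1) fun s => {p | s ∈ V p}))]
  · rfl
  · intro q U
    unfold enumSystem
    split_ifs
    · rfl
    · rfl

end Unravelling

/-! ### Formulas -/

namespace MuG

variable {S α : Type}

/-- Disjunction over a list. -/
def bigOr (l : List MuG) : MuG := l.foldr .or .bot

/-- Conjunction over a list. -/
def bigAnd (l : List MuG) : MuG := l.foldr .and .top

/-- Disjunction over a subset of a finite type. -/
noncomputable def iOr [Finite α] (s : Set α) (f : α → MuG) : MuG :=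
  bigOr (s.toFinite.toFinset.toList.map f)

/-- Conjunction over a subset of a finite type. -/
noncomputable def iAnd [Finite α] (s : Set α) (f : α → MuG) : MuG :=
  bigAnd (s.toFinite.toFinset.toList.map f)

theorem mem_sem_bigOr (σ : S → MObj S) (l : List MuG) (V : ℕ → Set S) (u : S) :
    u ∈ (bigOr l).sem σ V ↔ ∃ φ ∈ l, u ∈ φ.sem σ V := by
  induction l with
  | nil => exact iff_of_false (fun h => h) (by simp)
  | cons φ l ih =>
    rw [List.exists_mem_cons_iff, ← ih]
    rfl

theorem mem_sem_bigAnd (σ : S → MObj S) (l : List MuG) (V : ℕ → Set S) (u : S) :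
    u ∈ (bigAnd l).sem σ V ↔ ∀ φ ∈ l, u ∈ φ.sem σ V := by
  induction l with
  | nil => exact iff_of_true trivial (by simp)
  | cons φ l ih =>
    rw [List.forall_mem_cons, ← ih]
    rfl

theorem mem_sem_iOr [Finite α] (σ : S → MObj S) (s : Set α) (f : α → MuG) (V : ℕ → Set S)
    (u : S) : u ∈ (iOr s f).sem σ V ↔ ∃ a ∈ s, u ∈ (f a).sem σ V := by
  simp [iOr, mem_sem_bigOr]

theorem mem_sem_iAnd [Finite α] (σ : S → MObj S) (s : Set α) (f : α → MuG) (V : ℕ → Set S)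
    (u : S) : u ∈ (iAnd s f).sem σ V ↔ ∀ a ∈ s, u ∈ (f a).sem σ V := by
  simp [iAnd, mem_sem_bigAnd]

theorem posIn_bigOr {p : ℕ} {l : List MuG} (h : ∀ φ ∈ l, φ.PosIn p) : (bigOr l).PosIn p := by
  induction l with
  | nil => trivial
  | cons φ l ih => exact ⟨h _ (by simp), ih fun ψ hψ => h _ (by simp [hψ])⟩

theorem posIn_bigAnd {p : ℕ} {l : List MuG} (h : ∀ φ ∈ l, φ.PosIn p) : (bigAnd l).PosIn p := by
  induction l with
  | nil => trivial
  | cons φ l ih => exact ⟨h _ (by simp), ih fun ψ hψ => h _ (by simp [hψ])⟩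

theorem wf_bigOr {l : List MuG} (h : ∀ φ ∈ l, φ.WF) : (bigOr l).WF := by
  induction l with
  | nil => trivial
  | cons φ l ih => exact ⟨h _ (by simp), ih fun ψ hψ => h _ (by simp [hψ])⟩

theorem wf_bigAnd {l : List MuG} (h : ∀ φ ∈ l, φ.WF) : (bigAnd l).WF := by
  induction l with
  | nil => trivial
  | cons φ l ih => exact ⟨h _ (by simp), ih fun ψ hψ => h _ (by simp [hψ])⟩

theorem posIn_iOr [Finite α] {p : ℕ} (s : Set α) {f : α → MuG} (h : ∀ a, (f a).PosIn p) :
    (iOr s f).PosIn p :=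
  posIn_bigOr fun φ hφ => by obtain ⟨a, -, rfl⟩ := List.mem_map.1 hφ; exact h a

theorem posIn_iAnd [Finite α] {p : ℕ} (s : Set α) {f : α → MuG} (h : ∀ a, (f a).PosIn p) :
    (iAnd s f).PosIn p :=
  posIn_bigAnd fun φ hφ => by obtain ⟨a, -, rfl⟩ := List.mem_map.1 hφ; exact h a

theorem wf_iOr [Finite α] (s : Set α) {f : α → MuG} (h : ∀ a, (f a).WF) : (iOr s f).WF :=
  wf_bigOr fun φ hφ => by obtain ⟨a, -, rfl⟩ := List.mem_map.1 hφ; exact h a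

theorem wf_iAnd [Finite α] (s : Set α) {f : α → MuG} (h : ∀ a, (f a).WF) : (iAnd s f).WF :=
  wf_bigAnd fun φ hφ => by obtain ⟨a, -, rfl⟩ := List.mem_map.1 hφ; exact h a

/-- The formula expressing that some description in `T` applies. -/
noncomputable def ofTable (A : Aut) (T : Set A.Descr) (g : A.Q → MuG) (q : A.Q) : MuG :=
  iOr {x ∈ T | x.1 = q} fun x =>
    .and (iAnd Set.univ fun p : Fin A.bd => if p ∈ x.2.1 then .var p.1 else .nvar p.1) <|
    .and (.all (iOr Set.univ fun y : x.2.2.1 => iAnd y.1 g)) <|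
    .and (iAnd Set.univ fun y : x.2.2.1 => .exm (iAnd y.1 g)) <|
    .and (iAnd x.2.2.2 fun τ => .box (iOr τ fun y => iAnd y.1 g))
      (iAnd x.2.2.2ᶜ fun τ => .dia (iOr τᶜ fun y => iAnd y.1 g))

theorem mem_sem_ofTable (A : Aut) (T : Set A.Descr) (g : A.Q → MuG) (q : A.Q) (σ : S → MObj S)
    (V : ℕ → Set S) (s : S) : s ∈ (ofTable A T g q).sem σ V ↔
      ∃ x ∈ T, x.1 = q ∧ (∀ p, p ∈ x.2.1 ↔ s ∈ V p.1) ∧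
        Aut.Describes x.2.2.1 x.2.2.2 (σ s).1 fun k => (g k).sem σ V := by
  have hset : ∀ {G : Set (Set A.Q)} (τ : Set G),
      (iOr τ fun y => iAnd y.1 g).sem σ V = {t | ∃ x ∈ τ, ∀ k ∈ x.1, t ∈ (g k).sem σ V} := by
    intro G τ
    ext t
    simp only [mem_sem_iOr, mem_sem_iAnd, Set.mem_ofPred_eq]
  rw [ofTable, mem_sem_iOr]
  refine exists_congr fun x => ?_
  rw [Set.mem_ofPred_eq, and_assoc]
  refine and_congr_right fun _ => and_congr_right fun _ => and_congr ?_ (and_congr ?_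
    (and_congr ?_ (and_congr ?_ ?_)))
  · rw [mem_sem_iAnd]
    refine forall_congr' fun p => ?_
    by_cases hp : p ∈ x.2.1
    · simp [hp, sem]
    · simp [hp, sem]
  · refine forall_congr' fun t => ?_
    simp only [mem_sem_iOr, mem_sem_iAnd, Set.mem_univ, true_and]
  · rw [mem_sem_iAnd]
    refine forall_congr' fun y => ?_
    simp only [Set.mem_univ, true_imp_iff, sem, mem_sem_iAnd, Set.mem_ofPred_eq]
  · rw [mem_sem_iAnd]
    simp only [sem, hset, Set.mem_ofPred_eq]
  · rw [mem_sem_iAnd]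
    simp only [sem, hset, Set.mem_ofPred_eq, Set.mem_compl_iff]

theorem posIn_ofTable (A : Aut) (T : Set A.Descr) {g : A.Q → MuG} (q : A.Q) {p : ℕ}
    (hp : A.bd ≤ p) (hg : ∀ k, (g k).PosIn p) : (ofTable A T g q).PosIn p := by
  refine posIn_iOr _ fun x => ⟨posIn_iAnd _ fun r => ?_, posIn_iOr _ fun y => posIn_iAnd _ hg,
    posIn_iAnd _ fun y => posIn_iAnd y.1 hg, posIn_iAnd _ fun τ => posIn_iOr τ fun y =>
    posIn_iAnd _ hg, posIn_iAnd _ fun τ => posIn_iOr τᶜ fun y => posIn_iAnd _ hg⟩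
  split_ifs
  · trivial
  · exact (r.2.trans_le hp).ne

theorem wf_ofTable (A : Aut) (T : Set A.Descr) {g : A.Q → MuG} (q : A.Q)
    (hg : ∀ k, (g k).WF) : (ofTable A T g q).WF := by
  refine wf_iOr _ fun x => ⟨wf_iAnd _ fun r => ?_, wf_iOr _ fun y => wf_iAnd _ hg,
    wf_iAnd _ fun y => wf_iAnd y.1 hg, wf_iAnd _ fun τ => wf_iOr τ fun y =>
    wf_iAnd _ hg, wf_iAnd _ fun τ => wf_iOr τᶜ fun y => wf_iAnd _ hg⟩
  split_ifs <;> trivial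

/-- Formulas for the solution of a system of equations with right-hand sides given by `T`. -/
noncomputable def solution (Ω : ℕ → ℕ) (T : ℕ → (ℕ → MuG) → MuG) (b : ℕ) :
    ℕ → (ℕ → MuG) → ℕ → MuG
  | 0, e => e
  | n + 1, e => solution Ω T b n (Function.update e n
      (if Even (Ω n) then
        .nu (b + n) (T n (solution Ω T b n (Function.update e n (.var (b + n)))))
      else .mu (b + n) (T n (solution Ω T b n (Function.update e n (.var (b + n)))))))

variable {Ω : ℕ → ℕ} {T : ℕ → (ℕ → MuG) → MuG} {b : ℕ}

theorem posIn_solution {p : ℕ} (hT : ∀ n g, (∀ k, (g k).PosIn p) → (T n g).PosIn p) (n : ℕ) :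
    ∀ e : ℕ → MuG, (∀ k, (e k).PosIn p) → ∀ k, (solution Ω T b n e k).PosIn p := by
  induction n with
  | zero => exact fun e he => he
  | succ n ih =>
    intro e he
    have hu : ∀ φ : MuG, φ.PosIn p → ∀ k, (Function.update e n φ k).PosIn p := by
      intro φ hφ k
      rcases eq_or_ne k n with rfl | hk
      · rwa [Function.update_self]
      · rw [Function.update_of_ne hk]
        exact he k
    refine ih _ (hu _ ?_)
    have hb := hT n _ (ih _ (hu (.var (b + n)) trivial))
    split_ifs
    · exact Or.inr hb
    · exact Or.inr hb

theorem wf_solution (hT : ∀ n g p, b ≤ p → (∀ k, (g k).PosIn p) → (T n g).PosIn p)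
    (hT' : ∀ n g, (∀ k, (g k).WF) → (T n g).WF) (n : ℕ) :
    ∀ e : ℕ → MuG, (∀ k p, b ≤ p → (e k).PosIn p) → (∀ k, (e k).WF) →
      ∀ k, (solution Ω T b n e k).WF := by
  induction n with
  | zero => exact fun e _ he => he
  | succ n ih =>
    intro e he he'
    have hu : ∀ φ : MuG, (∀ p, b ≤ p → φ.PosIn p) →
        ∀ k p, b ≤ p → (Function.update e n φ k).PosIn p := by
      intro φ hφ k
      rcases eq_or_ne k n with rfl | hk
      · rwa [Function.update_self]
      · rw [Function.update_of_ne hk]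
        exact he k
    have hu' : ∀ φ : MuG, φ.WF → ∀ k, (Function.update e n φ k).WF := by
      intro φ hφ k
      rcases eq_or_ne k n with rfl | hk
      · rwa [Function.update_self]
      · rw [Function.update_of_ne hk]
        exact he' k
    have hv := hu (.var (b + n)) fun _ _ => trivial
    have hp : ∀ p, b ≤ p →
        (T n (solution Ω T b n (Function.update e n (.var (b + n))))).PosIn p := fun p hp =>
      hT n _ p hp (posIn_solution (fun n g => hT n g p hp) n _ fun k => hv k p hp)
    have hw := hT' n _ (ih _ hv (hu' (.var (b + n)) trivial))
    refine ih _ (hu _ fun p hbp => ?_) (hu' _ ?_)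
    · split_ifs
      · exact Or.inr (hp p hbp)
      · exact Or.inr (hp p hbp)
    · split_ifs
      · exact ⟨hp _ (Nat.le_add_right b n), hw⟩
      · exact ⟨hp _ (Nat.le_add_right b n), hw⟩

theorem sem_solution (σ : S → MObj S) {β : (ℕ → Set S) → ℕ → (ℕ → Set S) → Set S}
    (hβ : ∀ n g V, (T n g).sem σ V = β V n fun k => (g k).sem σ V)
    (hV : ∀ i V Z, β (updV V (b + i) Z) = β V) (n : ℕ) :
    ∀ e : ℕ → MuG, (∀ i < n, ∀ k V Z, (e k).sem σ (updV V (b + i) Z) = (e k).sem σ V) →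
      ∀ V, (fun k => (solution Ω T b n e k).sem σ V) = sol Ω (β V) n fun k => (e k).sem σ V := by
  induction n with
  | zero => exact fun _ _ _ => rfl
  | succ n ih =>
    intro e he V
    have hsem : ∀ (φ : MuG) V, (fun k => (Function.update e n φ k).sem σ V) =
        Function.update (fun k => (e k).sem σ V) n (φ.sem σ V) := by
      intro φ V
      ext1 k
      rcases eq_or_ne k n with rfl | hk
      · simp
      · simp [hk]
    have hind : ∀ φ : MuG, (∀ i < n, ∀ V Z, φ.sem σ (updV V (b + i) Z) = φ.sem σ V) →
        ∀ i < n, ∀ k V Z, (Function.update e n φ k).sem σ (updV V (b + i) Z) =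
          (Function.update e n φ k).sem σ V := by
      intro φ hφ i hi k
      rcases eq_or_ne k n with rfl | hk
      · simpa using hφ i hi
      · simpa [hk] using he i (hi.trans (Nat.lt_succ_self n)) k
    have hbody : ∀ V Z, (T n (solution Ω T b n (Function.update e n (.var (b + n))))).sem σ
        (updV V (b + n) Z) = β V n (sol Ω (β V) n
          (Function.update (fun k => (e k).sem σ V) n Z)) := by
      intro V Z
      rw [hβ, ih _ (hind _ fun i hi V Z => ?_), hV, hsem]
      · congr 2
        have h1 : (fun k => (e k).sem σ (updV V (b + n) Z)) = fun k => (e k).sem σ V :=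
          funext fun k => he n (Nat.lt_succ_self n) k V Z
        rw [h1]
        simp [sem, updV]
      · have : n ≠ i := by omega
        simp [sem, updV, this]
    set θ : MuG := if Even (Ω n) then
        .nu (b + n) (T n (solution Ω T b n (Function.update e n (.var (b + n)))))
      else .mu (b + n) (T n (solution Ω T b n (Function.update e n (.var (b + n))))) with hθ
    have hsemθ : ∀ V, θ.sem σ V = if Even (Ω n) then
        ⋃₀ {Z | Z ⊆ β V n (sol Ω (β V) n (Function.update (fun k => (e k).sem σ V) n Z))}
        else ⋂₀ {Z | β V n (sol Ω (β V) n (Function.update (fun k => (e k).sem σ V) n Z)) ⊆ Z} := by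
      intro V
      rw [hθ]
      split_ifs
      · simp only [sem, hbody]
      · simp only [sem, hbody]
    change (fun k => (solution Ω T b n (Function.update e n θ) k).sem σ V) = _
    rw [ih _ (hind _ fun i hi V Z => ?_), hsem, hsemθ]
    · rfl
    · have h1 : (fun k => (e k).sem σ (updV V (b + i) Z)) = fun k => (e k).sem σ V :=
        funext fun k => he i (hi.trans (Nat.lt_succ_self n)) k V Z
      rw [hsemθ, hsemθ, hV, h1]

end MuG

theorem Aut.system_congr {X D : Type} (A : Aut) (next : X → D → X) (𝔅 : X → Set (Set D))
    {col col' : X → Set ℕ} (h : ∀ x, ∀ p < A.bd, p ∈ col x ↔ p ∈ col' x) :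
    A.system next 𝔅 col = A.system next 𝔅 col' := by
  ext q U x
  exact ⟨A.transfer (Equiv.refl D) _ _ (fun _ => Iff.rfl) _ _ (h x) q _ _ fun _ _ hd => hd,
    A.transfer (Equiv.refl D) _ _ (fun _ => Iff.rfl) _ _ (fun p hp => (h x p hp).symm) q _ _
      fun _ _ hd => hd⟩

theorem exists_muG_of_globalBisimInv {φ : MMSOForm} (hφ : GlobalBisimInv φ) :
    ∃ ψ : MuG, ψ.WF ∧ ∀ (S : Type) (σ : S → MObj S) (V : ℕ → Set S) (u : S),
      φ.sat σ V u ↔ u ∈ ψ.sem σ V := by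
  obtain ⟨A, hA⟩ := exists_aut φ
  obtain ⟨m, e, he⟩ := exists_enum_monotone A.Ω
  obtain ⟨T, hT⟩ := A.exists_cofinal_table
  let F : ℕ → (ℕ → MuG) → MuG := fun n g =>
    if h : n < m then MuG.ofTable A T (fun k => g (e k)) (e.symm ⟨n, h⟩) else .bot
  refine ⟨MuG.solution (enumPriority e A.Ω) F A.bd m (fun _ => .bot) (e A.init),
    MuG.wf_solution (fun n g p hp hg => ?_) (fun n g hg => ?_) m (fun _ => .bot)
      (fun _ _ _ => trivial) (fun _ => trivial) _, fun S σ V u => ?_⟩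
  · simp only [F]
    split_ifs
    · exact MuG.posIn_ofTable A T _ hp fun k => hg _
    · trivial
  · simp only [F]
    split_ifs
    · exact MuG.wf_ofTable A T _ fun k => hg _
    · trivial
  · obtain ⟨K, _, hK, hKT⟩ := hT S
    let β : (ℕ → Set S) → ℕ → (ℕ → Set S) → Set S := fun V =>
      enumSystem e (A.system (fun _ d => Expn.lab d) (fun s => Expn.blocks K (σ s).1)
        fun s => {p | s ∈ V p})
    have hβ : ∀ n g V, (F n g).sem σ V = β V n fun k => (g k).sem σ V := by
      intro n g V
      simp only [F, β, enumSystem]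
      split_ifs
      · ext s
        rw [MuG.mem_sem_ofTable, ← hKT]
        exact (A.delta_iff_exists_describes hK (σ s) {p | s ∈ V p} (e.symm ⟨n, _⟩)
          fun k => (g (e k)).sem σ V).symm
      · rfl
    have hV : ∀ i V Z, β (updV V (A.bd + i) Z) = β V := by
      intro i V Z
      simp only [β]
      rw [A.system_congr]
      intro s p hp
      have : p ≠ A.bd + i := by omega
      simp [updV, this]
    rw [sat_iff_mem_sol (K := K) hφ hA he (fun _ => ∅)]
    have := congrFun (MuG.sem_solution (Ω := enumPriority e A.Ω) σ hβ hV m (fun _ => .bot)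
      (fun _ _ _ _ _ => rfl) V) (e A.init)
    exact (Set.ext_iff.1 this u).symm

/-- An `MMSO`-formula is invariant for global neighborhood
bisimulations iff it is equivalent, over all pointed monotone neighborhood models,
to a formula of the monotone modal μ-calculus with the global modalities. -/
theorem mmso_global_bisim_invariance_characterization (φ : MMSOForm) :
    GlobalBisimInv φ ↔
      ∃ ψ : MuG, ψ.WF ∧
        ∀ (S : Type) (σ : S → MObj S) (V : ℕ → Set S) (u : S),
          φ.sat σ V u ↔ u ∈ ψ.sem σ V := by
  refine ⟨exists_muG_of_globalBisimInv, ?_⟩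
  rintro ⟨ψ, hψ, h⟩ S₁ σ₁ V₁ s₁ S₂ σ₂ V₂ s₂ R hR hs
  rw [h, h]
  exact MuG.sem_iff_of_globalNBisim hR hψ hs
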